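/- Let k≥4 be an integer, let G and G' be two (≤k)-hypomorphic digraphs on the same vertex set such that G does not satisfy condition C_∞, and let C∈D_{G,G'} be a difference class with G[C] not self-dual. Then: (1) if k=4, G[C] is a one-end infinite consecutivity or a proper prechain; (2) if k=5, G[C] is a one-end infinite consecutivity or a diamond-free tournament; (3) if k=6, G[C] is a one-end infinite consecutivity; (4) if G is a prechain, then G and G' are hemimorphic. -/

import Mathlib

universe u v

/-- A digraph: an irreflexive binary relation on a vertex type. -/
structure Dgraph (V : Type u) where
  Arc : V → V → Prop
  irrefl : ∀ x, ¬ Arc x x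

namespace Dgraph

variable {V : Type u} {W : Type v}

/-- The dual digraph. -/
def dual (G : Dgraph V) : Dgraph V :=
  ⟨fun x y => G.Arc y x, fun x h => G.irrefl x h⟩

/-- Subdigraph induced by a set of vertices. -/
def ind (G : Dgraph V) (X : Set V) : Dgraph X :=
  ⟨fun x y => G.Arc x y, fun x h => G.irrefl x h⟩

/-- Isomorphism of digraphs. -/
def Iso (G : Dgraph V) (G' : Dgraph W) : Prop :=
  ∃ e : V ≃ W, ∀ x y, G.Arc x y ↔ G'.Arc (e x) (e y)

/-- `G` and `G'` are hemimorphic: `G'` is isomorphic to `G` or to its dual. -/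
def Hemi (G : Dgraph V) (G' : Dgraph W) : Prop :=
  Iso G G' ∨ Iso G.dual G'

/-- Self-dual digraph. -/
def SelfDual (G : Dgraph V) : Prop := Iso G G.dual

/-- `{x,y}` is a directed pair. -/
def Dir (G : Dgraph V) (x y : V) : Prop :=
  (G.Arc x y ∧ ¬ G.Arc y x) ∨ (G.Arc y x ∧ ¬ G.Arc x y)

/-- `{x,y}` is a neutral pair (full or void). -/
def Neutral (G : Dgraph V) (x y : V) : Prop :=
  x ≠ y ∧ ¬ G.Dir x y

/-- Interval of a digraph. -/
def IsInterval (G : Dgraph V) (I : Set V) : Prop :=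
  ∀ x ∉ I,
    (∀ y ∈ I, G.Arc x y ∧ ¬ G.Arc y x) ∨ (∀ y ∈ I, G.Arc y x ∧ ¬ G.Arc x y) ∨
    (∀ y ∈ I, G.Arc x y ∧ G.Arc y x) ∨ (∀ y ∈ I, ¬ G.Arc x y ∧ ¬ G.Arc y x)

/-- The arc-connectivity equivalence relation. -/
def ACRel (G : Dgraph V) : V → V → Prop := Relation.ReflTransGen G.Dir

/-- Arc-connected components. -/
def IsACComponent (G : Dgraph V) (D : Set V) : Prop :=
  ∃ x, D = {y | G.ACRel x y}

/-- Arc-connected digraph (at most one arc-connected component). -/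
def ArcConnected (G : Dgraph V) : Prop := ∀ x y, G.ACRel x y

/-- Tournament. -/
def IsTournament (G : Dgraph V) : Prop := ∀ x y, x ≠ y → G.Dir x y

/-- Chain (transitive tournament). -/
def IsChainD (G : Dgraph V) : Prop :=
  G.IsTournament ∧ ∀ x y z, G.Arc x y → G.Arc y z → G.Arc x z

/-- Dgraph from a relation, with forced irreflexivity. -/
def ofRel (r : V → V → Prop) : Dgraph V := ⟨fun x y => x ≠ y ∧ r x y, fun x h => h.1 rfl⟩

/-- The model flag. -/
def flagD : Dgraph (Fin 3) :=
  ofRel (fun x y => (x = 0 ∧ y = 1) ∨ (x = 1 ∧ y = 2) ∨ (x = 2 ∧ y = 1))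

/-- First model peak. -/
def peakD1 : Dgraph (Fin 3) :=
  ofRel (fun x y => (x = 0 ∧ y = 1) ∨ (x = 0 ∧ y = 2) ∨ (x = 1 ∧ y = 2) ∨ (x = 2 ∧ y = 1))

/-- Second model peak. -/
def peakD2 : Dgraph (Fin 3) :=
  ofRel (fun x y => (x = 0 ∧ y = 1) ∨ (x = 0 ∧ y = 2))

/-- The model diamond. -/
def diamondD : Dgraph (Fin 4) :=
  ofRel (fun x y => (x = 0 ∧ y = 1) ∨ (x = 0 ∧ y = 2) ∨ (x = 0 ∧ y = 3) ∨
    (x = 1 ∧ y = 2) ∨ (x = 2 ∧ y = 3) ∨ (x = 3 ∧ y = 1))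

/-- A flag is a digraph hemimorphic to the model flag. -/
def IsFlag (G : Dgraph V) : Prop := Hemi G flagD

/-- A peak is a digraph hemimorphic to one of the two model peaks. -/
def IsPeak (G : Dgraph V) : Prop := Hemi G peakD1 ∨ Hemi G peakD2

/-- A diamond is a digraph hemimorphic to the model diamond. -/
def IsDiamond (G : Dgraph V) : Prop := Hemi G diamondD

/-- Prechain: embeds no peak, no diamond, no two adjacent neutral pairs. -/
def IsPrechain (G : Dgraph V) : Prop :=
  (∀ X : Set V, ¬ IsPeak (G.ind X)) ∧ (∀ X : Set V, ¬ IsDiamond (G.ind X)) ∧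
  ¬ ∃ x y z : V, y ≠ z ∧ G.Neutral x y ∧ G.Neutral x z

/-- Proper prechain: a prechain which is not a chain. -/
def ProperPrechain (G : Dgraph V) : Prop := G.IsPrechain ∧ ¬ G.IsChainD

/-- Diamond-free tournament. -/
def DiamondFreeTournament (G : Dgraph V) : Prop :=
  G.IsTournament ∧ ∀ X : Set V, ¬ IsDiamond (G.ind X)

/-- Non-tournament prechain. -/
def NonTournamentPrechain (G : Dgraph V) : Prop := G.IsPrechain ∧ ¬ G.IsTournament

/-- Model finite consecutivity on `n` vertices (`full` decides whether the
non-consecutive pairs are all full or all void). -/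
def consecFin (n : ℕ) (full : Bool) : Dgraph (Fin n) :=
  ofRel (fun i j => i.1 + 1 = j.1 ∨ (full = true ∧ (i.1 + 1 < j.1 ∨ j.1 + 1 < i.1)))

/-- Model consecutivity of type ω. -/
def consecNat (full : Bool) : Dgraph ℕ :=
  ofRel (fun i j => i + 1 = j ∨ (full = true ∧ (i + 1 < j ∨ j + 1 < i)))

/-- Model consecutivity of type ω*+ω. -/
def consecInt (full : Bool) : Dgraph ℤ :=
  ofRel (fun i j => i + 1 = j ∨ (full = true ∧ (i + 1 < j ∨ j + 1 < i)))

/-- One-end infinite consecutivity (obtained from ω or ω*). -/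
def OneEndInfiniteConsecutivity (G : Dgraph V) : Prop :=
  ∃ full, Iso G (consecNat full) ∨ Iso G (consecNat full).dual

/-- Consecutivity. -/
def IsConsecutivity (G : Dgraph V) : Prop :=
  (∃ n, 3 ≤ n ∧ ∃ full, Iso G (consecFin n full)) ∨
  G.OneEndInfiniteConsecutivity ∨ (∃ full, Iso G (consecInt full))

/-- Model cycle on `n ≥ 3` vertices obtained from the finite consecutivity by
replacing the neutral pair `{0, n-1}` by the arc `(n-1, 0)`. -/
def cycleD (n : ℕ) (full : Bool) : Dgraph (Fin n) :=
  ofRel (fun i j => i.1 + 1 = j.1 ∨ (i.1 = n - 1 ∧ j.1 = 0) ∨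
    (full = true ∧ (i.1 + 1 < j.1 ∨ j.1 + 1 < i.1) ∧
      ¬ (i.1 = 0 ∧ j.1 = n - 1) ∧ ¬ (i.1 = n - 1 ∧ j.1 = 0)))

/-- Cycle. -/
def IsCycle (G : Dgraph V) : Prop := ∃ n, 3 ≤ n ∧ ∃ full, Iso G (cycleD n full)

/-- Near-chain: obtained from a chain by exchanging the directed pair formed
by its extremities. -/
def IsNearChain (G : Dgraph V) : Prop :=
  ∃ (H : Dgraph V) (m M : V), H.IsChainD ∧ m ≠ M ∧
    (∀ x, x ≠ m → H.Arc m x) ∧ (∀ x, x ≠ M → H.Arc x M) ∧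
    (∀ x y, G.Arc x y ↔ ((H.Arc x y ∧ ¬ (x = m ∧ y = M)) ∨ (x = M ∧ y = m)))

/-- `{k}`-hypomorphy. -/
def KHypo (k : ℕ) (G G' : Dgraph V) : Prop :=
  ∀ X : Set V, X.Finite → X.ncard = k → Iso (G.ind X) (G'.ind X)

/-- `(≤ k)`-hypomorphy. -/
def LeHypo (k : ℕ) (G G' : Dgraph V) : Prop :=
  ∀ j, 1 ≤ j → j ≤ k → KHypo j G G'

/-- `{k}`-hemimorphy. -/
def KHemi (k : ℕ) (G G' : Dgraph V) : Prop :=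
  ∀ X : Set V, X.Finite → X.ncard = k → Hemi (G.ind X) (G'.ind X)

/-- `(≤ k)`-hemimorphy. -/
def LeHemi (k : ℕ) (G G' : Dgraph V) : Prop :=
  ∀ j, 1 ≤ j → j ≤ k → KHemi j G G'

/-- `(≤ k)`-half-reconstructibility. -/
def HalfRecon (k : ℕ) (G : Dgraph V) : Prop :=
  ∀ G' : Dgraph V, LeHemi k G G' → Hemi G G'

/-- One step of the difference relation. -/
def DiffStep (G G' : Dgraph V) (x y : V) : Prop := G.Arc x y ↔ ¬ G'.Arc x y

/-- The difference relation `𝔇_{G,G'}`. -/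
def DiffRel (G G' : Dgraph V) (x y : V) : Prop :=
  x = y ∨ Relation.TransGen (DiffStep G G') x y

/-- Difference classes: `C ∈ D_{G,G'}`. -/
def DiffClass (G G' : Dgraph V) (C : Set V) : Prop :=
  ∃ x, C = {y | DiffRel G G' x y}

/-- The difference relation has at least two equivalence classes. -/
def AtLeastTwoDiffClasses (G G' : Dgraph V) : Prop :=
  ∃ C₁ C₂ : Set V, DiffClass G G' C₁ ∧ DiffClass G G' C₂ ∧ C₁ ≠ C₂

/-- `C_dual(G)`: the smallest cardinality of a finite set of vertices inducing a
non-self-dual subdigraph (`⊤` if there is none). -/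
noncomputable def Cdual (G : Dgraph V) : ℕ∞ :=
  sInf {n : ℕ∞ | ∃ X : Set V, X.Finite ∧ ¬ SelfDual (G.ind X) ∧ n = (X.ncard : ℕ∞)}

/-- The contracted digraph `G_I` (the vertex `none` plays the role of `I`). -/
def contract (G : Dgraph V) (I : Set V) : Dgraph (Option {x : V // x ∉ I}) where
  Arc := fun a b =>
    match a, b with
    | some x, some y => G.Arc x.1 y.1
    | some x, none => ∃ z ∈ I, G.Arc x.1 z
    | none, some y => ∃ z ∈ I, G.Arc z y.1
    | none, none => False
  irrefl := by
    rintro (_ | ⟨x, hx⟩)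
    · simp
    · exact G.irrefl x

/-- There is an isomorphism `f` from `G_I` onto `G'_I` with `f(I) = I`. -/
def ContractIsoFix (G G' : Dgraph V) (I : Set V) : Prop :=
  ∃ e : Option {x : V // x ∉ I} ≃ Option {x : V // x ∉ I},
    e none = none ∧ ∀ a b, (G.contract I).Arc a b ↔ (G'.contract I).Arc (e a) (e b)

/-- `D` is disjoint from every flag of `G`. -/
def FlagDisjoint (G : Dgraph V) (D : Set V) : Prop :=
  ∀ F : Set V, IsFlag (G.ind F) → D ∩ F = ∅

/-- `D` contains a vertex `a` of a flag `{a,b,c}` of `G` with `b, c ∉ D` and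
`{b,c}` the directed pair of the flag. -/
def FlagVertexCond (G : Dgraph V) (D : Set V) : Prop :=
  ∃ a ∈ D, ∃ b c : V, b ∉ D ∧ c ∉ D ∧ IsFlag (G.ind {a, b, c}) ∧ G.Dir b c

/-- Condition `C_∞`. -/
def CondCinf (G : Dgraph V) : Prop :=
  (∃ I : Set V, I.Infinite ∧ G.IsInterval I ∧ (G.ind I).IsChainD) ∨
  (∃ I J : Set V, I ≠ J ∧ G.IsInterval I ∧ G.IsInterval J ∧
     (G.ind I).OneEndInfiniteConsecutivity ∧ (G.ind J).OneEndInfiniteConsecutivity) ∨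
  (∃ I : Set V, G.IsInterval I ∧ (G.ind I).OneEndInfiniteConsecutivity ∧
     (∀ J : Set V, G.IsInterval J → (G.ind J).OneEndInfiniteConsecutivity → J = I) ∧
     ¬ ContractIsoFix G G.dual I)

/-- The kind of component occurring in conditions `K1` and `K2`. -/
def K12Kind (G : Dgraph V) (D : Set V) : Prop :=
  DiamondFreeTournament (G.ind D) ∨ (NonTournamentPrechain (G.ind D) ∧ G.FlagDisjoint D)

/-- Condition `K1`. -/
def CondK1 (G : Dgraph V) : Prop :=
  G.Cdual = 3 ∧ ∃ D₁ D₂ : Set V, D₁ ≠ D₂ ∧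
    (G.IsACComponent D₁ ∧ ¬ SelfDual (G.ind D₁) ∧ G.IsInterval D₁ ∧ G.K12Kind D₁) ∧
    (G.IsACComponent D₂ ∧ ¬ SelfDual (G.ind D₂) ∧ G.IsInterval D₂ ∧ G.K12Kind D₂)

/-- Condition `K2`. -/
def CondK2 (G : Dgraph V) : Prop :=
  G.Cdual = 3 ∧ ∃ D₀ : Set V, G.IsACComponent D₀ ∧ ¬ SelfDual (G.ind D₀) ∧
    (∀ D, G.IsACComponent D → ¬ SelfDual (G.ind D) → D = D₀) ∧
    G.K12Kind D₀ ∧ ¬ ContractIsoFix G G.dual D₀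

/-- Condition `K3`. -/
def CondK3 (G : Dgraph V) : Prop :=
  G.Cdual = 4 ∧ ∃ D₁ D₂ : Set V, D₁ ≠ D₂ ∧
    (G.IsACComponent D₁ ∧ ¬ SelfDual (G.ind D₁) ∧ G.IsInterval D₁) ∧
    (G.IsACComponent D₂ ∧ ¬ SelfDual (G.ind D₂) ∧ G.IsInterval D₂)

/-- Condition `K4`. -/
def CondK4 (G : Dgraph V) : Prop :=
  G.Cdual = 5 ∧ ∃ D₁ D₂ : Set V, D₁ ≠ D₂ ∧
    (G.IsACComponent D₁ ∧ ¬ SelfDual (G.ind D₁) ∧ G.IsInterval D₁ ∧ IsPrechain (G.ind D₁)) ∧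
    (G.IsACComponent D₂ ∧ ¬ SelfDual (G.ind D₂) ∧ G.IsInterval D₂ ∧ IsPrechain (G.ind D₂))

/-- Condition `K5`. -/
def CondK5 (G : Dgraph V) : Prop :=
  G.Cdual = 6 ∧ ∃ D₁ D₂ : Set V, D₁ ≠ D₂ ∧
    (G.IsACComponent D₁ ∧ ¬ SelfDual (G.ind D₁) ∧ G.IsInterval D₁ ∧
      DiamondFreeTournament (G.ind D₁)) ∧
    (G.IsACComponent D₂ ∧ ¬ SelfDual (G.ind D₂) ∧ G.IsInterval D₂ ∧
      DiamondFreeTournament (G.ind D₂))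

/-- The kind of interval occurring in conditions `L1` and `L2`. -/
def L12Int (G : Dgraph V) (I : Set V) : Prop :=
  G.IsInterval I ∧ DiamondFreeTournament (G.ind I) ∧ ¬ SelfDual (G.ind I) ∧
    ¬ G.IsACComponent I

/-- Condition `L1`. -/
def CondL1 (G : Dgraph V) : Prop :=
  ∃ I₁ I₂ : Set V, I₁ ≠ I₂ ∧ G.L12Int I₁ ∧ G.L12Int I₂

/-- Condition `L2`. -/
def CondL2 (G : Dgraph V) : Prop :=
  ∃ I₀ : Set V, G.L12Int I₀ ∧ (∀ I, G.L12Int I → I = I₀) ∧ ¬ ContractIsoFix G G.dual I₀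

/-- Condition `L3`. -/
def CondL3 (G : Dgraph V) : Prop :=
  G.Cdual = 3 ∧ ∃ D₁ D₂ : Set V, D₁ ≠ D₂ ∧
    (G.IsACComponent D₁ ∧ ¬ SelfDual (G.ind D₁) ∧ G.IsInterval D₁) ∧
    (G.IsACComponent D₂ ∧ ¬ SelfDual (G.ind D₂) ∧ G.IsInterval D₂) ∧
    ((G.FlagDisjoint D₁ ∧ Cdual (G.ind D₁) = 4 ∧ G.FlagDisjoint D₂ ∧ Cdual (G.ind D₂) = 4) ∨
     (NonTournamentPrechain (G.ind D₁) ∧ G.FlagVertexCond D₁ ∧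
      NonTournamentPrechain (G.ind D₂) ∧ G.FlagVertexCond D₂))

/-- Condition `L4`. -/
def CondL4 (G : Dgraph V) : Prop :=
  G.Cdual = 3 ∧ ∃ D₀ : Set V, G.IsACComponent D₀ ∧ ¬ SelfDual (G.ind D₀) ∧
    (∀ D, G.IsACComponent D → ¬ SelfDual (G.ind D) → D = D₀) ∧
    G.IsInterval D₀ ∧
    ((G.FlagDisjoint D₀ ∧ Cdual (G.ind D₀) = 4) ∨
     (NonTournamentPrechain (G.ind D₀) ∧ G.FlagVertexCond D₀)) ∧
    ¬ ContractIsoFix G G.dual D₀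

end Dgraph

open Dgraph

namespace Dgraph

variable {V : Type u} {W : Type v}

/-- `x → y`: the pair `{x, y}` is directed from `x` to `y`. -/
def To (G : Dgraph V) (x y : V) : Prop := G.Arc x y ∧ ¬ G.Arc y x

theorem To.ne {G : Dgraph V} {x y : V} (h : G.To x y) : x ≠ y := by
  rintro rfl; exact h.2 h.1

theorem To.asymm {G : Dgraph V} {x y : V} (h : G.To x y) : ¬ G.To y x := fun h' => h.2 h'.1

theorem dir_iff (G : Dgraph V) (x y : V) : G.Dir x y ↔ G.To x y ∨ G.To y x := Iff.rfl

theorem neutral_iff (G : Dgraph V) (x y : V) :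
    G.Neutral x y ↔ x ≠ y ∧ (G.Arc x y ↔ G.Arc y x) := by
  unfold Neutral Dir; tauto

theorem Neutral.symm {G : Dgraph V} {x y : V} (h : G.Neutral x y) : G.Neutral y x := by
  rw [neutral_iff] at *; exact ⟨h.1.symm, h.2.symm⟩

theorem trichotomy (G : Dgraph V) {x y : V} (h : x ≠ y) :
    G.To x y ∨ G.To y x ∨ G.Neutral x y := by
  rw [neutral_iff]; unfold To; tauto

theorem Neutral.not_to {G : Dgraph V} {x y : V} (h : G.Neutral x y) :
    ¬ G.To x y ∧ ¬ G.To y x := by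
  rw [neutral_iff] at h; unfold To; tauto

theorem Iso.symm {G : Dgraph V} {H : Dgraph W} (h : Iso G H) : Iso H G := by
  obtain ⟨e, he⟩ := h
  exact ⟨e.symm, fun x y => by rw [he]; simp⟩

theorem Iso.trans {U : Type*} {G : Dgraph V} {H : Dgraph W} {K : Dgraph U}
    (h : Iso G H) (h' : Iso H K) : Iso G K := by
  obtain ⟨e, he⟩ := h
  obtain ⟨f, hf⟩ := h'
  exact ⟨e.trans f, fun x y => by rw [he, hf]; rfl⟩

theorem Iso.dual {G : Dgraph V} {H : Dgraph W} (h : Iso G H) : Iso G.dual H.dual := by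
  obtain ⟨e, he⟩ := h
  exact ⟨e, fun x y => he y x⟩

theorem LeHypo.mono {k l : ℕ} {G G' : Dgraph V} (h : LeHypo k G G') (hl : l ≤ k) :
    LeHypo l G G' := fun j h1 h2 => h j h1 (h2.trans hl)

theorem LeHypo.dual {k : ℕ} {G G' : Dgraph V} (h : LeHypo k G G') :
    LeHypo k G.dual G'.dual := fun j h1 h2 X hX hc => (h j h1 h2 X hX hc).dual

/-- A hypomorphy gives, for every injective tuple, a permutation of its indices. -/
theorem LeHypo.exists_perm {k : ℕ} {G G' : Dgraph V} (h : LeHypo k G G') {n : ℕ}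
    (hn : 1 ≤ n) (hk : n ≤ k) (v : Fin n → V) (hv : Function.Injective v) :
    ∃ σ : Equiv.Perm (Fin n), ∀ i j, G.Arc (v i) (v j) ↔ G'.Arc (v (σ i)) (v (σ j)) := by
  have hcard : (Set.range v).ncard = n := by
    rw [← Set.image_univ, Set.ncard_image_of_injective _ hv]; simp
  obtain ⟨e, he⟩ := h n hn hk (Set.range v) (Set.finite_range v) hcard
  let f := Equiv.ofInjective v hv
  refine ⟨(f.trans e).trans f.symm, fun i j => ?_⟩
  have key : ∀ i, v (((f.trans e).trans f.symm) i) = (e (f i)).1 := fun i => by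
    exact congrArg Subtype.val (f.apply_symm_apply (e (f i)))
  rw [key, key]
  exact he (f i) (f j)

section Rules

variable {G G' : Dgraph V}

theorem pair_rule (h : LeHypo 4 G G') {x y : V} (hxy : x ≠ y) :
    ((G.Arc x y ↔ G'.Arc x y) ∧ (G.Arc y x ↔ G'.Arc y x)) ∨
    ((G.Arc x y ↔ G'.Arc y x) ∧ (G.Arc y x ↔ G'.Arc x y)) := by
  obtain ⟨σ, hσ⟩ := h.exists_perm (n := 2) (by norm_num) (by norm_num) ![x, y] (by
    intro i j; fin_cases i <;> fin_cases j <;> simp [hxy, hxy.symm])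
  have h01 := hσ 0 1
  have h10 := hσ 1 0
  have hne : σ 0 ≠ σ 1 := by simp
  generalize σ 0 = s at *
  generalize σ 1 = t at *
  fin_cases s <;> fin_cases t <;> simp_all

theorem diffStep_iff (h : LeHypo 4 G G') (x y : V) :
    DiffStep G G' x y ↔ (G.To x y ∧ G'.To y x) ∨ (G.To y x ∧ G'.To x y) := by
  by_cases hxy : x = y
  · subst hxy
    have := G.irrefl x
    have := G'.irrefl x
    unfold DiffStep To; tauto
  · have := pair_rule h hxy
    unfold DiffStep To; tauto

theorem DiffStep.symm (h : LeHypo 4 G G') {x y : V} (hxy : DiffStep G G' x y) :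
    DiffStep G G' y x := by
  rw [diffStep_iff h] at *; tauto

theorem not_diffStep {x y : V} (hxy : ¬ DiffStep G G' x y) :
    G.Arc x y ↔ G'.Arc x y := by
  unfold DiffStep at hxy; tauto

/-- The possible shapes of a hypomorphy on three vertices. -/
theorem triple_rule (h : LeHypo 4 G G') {a b c : V} (hab : a ≠ b) (hac : a ≠ c) (hbc : b ≠ c) :
    ∃ x y z, ((x = a ∧ y = b ∧ z = c) ∨ (x = a ∧ y = c ∧ z = b) ∨ (x = b ∧ y = a ∧ z = c) ∨
      (x = b ∧ y = c ∧ z = a) ∨ (x = c ∧ y = a ∧ z = b) ∨ (x = c ∧ y = b ∧ z = a)) ∧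
    (G.Arc a b ↔ G'.Arc x y) ∧ (G.Arc b a ↔ G'.Arc y x) ∧
    (G.Arc a c ↔ G'.Arc x z) ∧ (G.Arc c a ↔ G'.Arc z x) ∧
    (G.Arc b c ↔ G'.Arc y z) ∧ (G.Arc c b ↔ G'.Arc z y) := by
  obtain ⟨σ, hσ⟩ := h.exists_perm (n := 3) (by norm_num) (by norm_num) ![a, b, c] (by
    intro i j; fin_cases i <;> fin_cases j <;>
      simp [hab, hab.symm, hac, hac.symm, hbc, hbc.symm])
  refine ⟨![a, b, c] (σ 0), ![a, b, c] (σ 1), ![a, b, c] (σ 2), ?_,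
    hσ 0 1, hσ 1 0, hσ 0 2, hσ 2 0, hσ 1 2, hσ 2 1⟩
  have h1 : σ 0 ≠ σ 1 := by simp
  have h2 : σ 0 ≠ σ 2 := by simp
  have h3 : σ 1 ≠ σ 2 := by simp
  clear hσ
  generalize σ 0 = s at *
  generalize σ 1 = t at *
  generalize σ 2 = r at *
  fin_cases s <;> fin_cases t <;> fin_cases r <;> simp_all

/-- The relation between a reversed pair and a vertex which is neutral to one of its ends. -/
theorem rev_neutral (h : LeHypo 4 G G') {a b c : V} (hab : DiffStep G G' a b)
    (hac : G.Neutral a c) (hbc : b ≠ c) :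
    (G.Neutral b c ∧ (G.Arc c a ↔ G.Arc c b)) ∨
    (DiffStep G G' b c ∧ ((G.To a b ∧ G.To b c) ∨ (G.To b a ∧ G.To c b))) := by
  rw [diffStep_iff h] at *
  rw [neutral_iff] at *
  have hab' : a ≠ b := by rcases hab with h | h; exacts [h.1.ne, h.1.ne.symm]
  obtain ⟨x, y, z, hx, h1⟩ := triple_rule h hab' hac.1 hbc
  have p1 := pair_rule h hac.1
  have p2 := pair_rule h hbc
  unfold To at *
  rcases hx with ⟨rfl, rfl, rfl⟩ | ⟨rfl, rfl, rfl⟩ | ⟨rfl, rfl, rfl⟩ | ⟨rfl, rfl, rfl⟩ |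
    ⟨rfl, rfl, rfl⟩ | ⟨rfl, rfl, rfl⟩ <;> grind

/-- In a directed 3-cycle all pairs are reversed or none is. -/
theorem rev_cycle (h : LeHypo 4 G G') {a b c : V} (hab : G.To a b) (hbc : G.To b c)
    (hca : G.To c a) (hr : DiffStep G G' a b) : DiffStep G G' b c ∧ DiffStep G G' c a := by
  have p1 := pair_rule h hab.ne
  have p2 := pair_rule h hbc.ne
  have p3 := pair_rule h hca.ne
  obtain ⟨x, y, z, hx, h1⟩ := triple_rule h hab.ne hca.ne.symm hbc.ne
  simp only [diffStep_iff h] at *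
  unfold To at *
  rcases hx with ⟨rfl, rfl, rfl⟩ | ⟨rfl, rfl, rfl⟩ | ⟨rfl, rfl, rfl⟩ | ⟨rfl, rfl, rfl⟩ |
    ⟨rfl, rfl, rfl⟩ | ⟨rfl, rfl, rfl⟩ <;> grind

/-- The possible reversals in a transitive triple. -/
theorem rev_trans (h : LeHypo 4 G G') {a b c : V} (hab : G.To a b) (hbc : G.To b c)
    (hac : G.To a c) : (DiffStep G G' a c → DiffStep G G' a b ∨ DiffStep G G' b c) ∧
    (DiffStep G G' a b → DiffStep G G' b c → DiffStep G G' a c) := by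
  have p1 := pair_rule h hab.ne
  have p2 := pair_rule h hbc.ne
  have p3 := pair_rule h hac.ne
  obtain ⟨x, y, z, hx, h1⟩ := triple_rule h hab.ne hac.ne hbc.ne
  simp only [diffStep_iff h] at *
  unfold To at *
  rcases hx with ⟨rfl, rfl, rfl⟩ | ⟨rfl, rfl, rfl⟩ | ⟨rfl, rfl, rfl⟩ | ⟨rfl, rfl, rfl⟩ |
    ⟨rfl, rfl, rfl⟩ | ⟨rfl, rfl, rfl⟩ <;> grind

end Rules

theorem exists_ind_iso_iff (G : Dgraph V) {n : ℕ} (H : Dgraph (Fin n)) :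
    (∃ X : Set V, Iso (G.ind X) H) ↔
      ∃ v : Fin n → V, Function.Injective v ∧ ∀ i j, G.Arc (v i) (v j) ↔ H.Arc i j := by
  constructor
  · rintro ⟨X, e, he⟩
    refine ⟨fun i => (e.symm i).1, fun i j h => e.symm.injective (Subtype.ext h), fun i j => ?_⟩
    have := he (e.symm i) (e.symm j)
    simp only [Equiv.apply_symm_apply] at this
    exact this
  · rintro ⟨v, hv, h⟩
    refine ⟨Set.range v, Iso.symm ⟨Equiv.ofInjective v hv, fun i j => (h i j).symm⟩⟩

/-- Elementwise form of the prechain property. -/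
structure Pre (G : Dgraph V) : Prop where
  out_peak : ∀ {a b c}, G.Neutral b c → G.To a b → ¬ G.To a c
  in_peak : ∀ {a b c}, G.Neutral b c → G.To b a → ¬ G.To c a
  out_dia : ∀ {a b c d}, G.To b c → G.To c d → G.To d b → G.To a b → G.To a c → ¬ G.To a d
  in_dia : ∀ {a b c d}, G.To b c → G.To c d → G.To d b → G.To b a → G.To c a → ¬ G.To d a
  nn : ∀ {x y z}, G.Neutral x y → G.Neutral x z → y = z

theorem not_peak_iff (G : Dgraph V) : (∀ X : Set V, ¬ IsPeak (G.ind X)) ↔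
    ∀ a b c, G.Neutral b c → (G.To a b → ¬ G.To a c) ∧ (G.To b a → ¬ G.To c a) := by
  have inj : ∀ {a b c : V}, a ≠ b → a ≠ c → b ≠ c → Function.Injective ![a, b, c] := by
    intro a b c h1 h2 h3 i j
    fin_cases i <;> fin_cases j <;> simp [h1, h2, h3, h1.symm, h2.symm, h3.symm]
  constructor
  · intro h a b c hn
    have h1 : ∀ H : Dgraph (Fin 3), (H = peakD1 ∨ H = peakD2) → ∀ v : Fin 3 → V,
        Function.Injective v → ¬ ∀ i j, G.Arc (v i) (v j) ↔ H.Arc i j := by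
      rintro H hH v hv hiso
      obtain ⟨X, hX⟩ := (exists_ind_iso_iff G H).2 ⟨v, hv, hiso⟩
      rcases hH with rfl | rfl
      · exact h X (Or.inl (Or.inl hX))
      · exact h X (Or.inr (Or.inl hX))
    have h2 : ∀ H : Dgraph (Fin 3), (H = peakD1 ∨ H = peakD2) → ∀ v : Fin 3 → V,
        Function.Injective v → ¬ ∀ i j, G.dual.Arc (v i) (v j) ↔ H.Arc i j := by
      rintro H hH v hv hiso
      obtain ⟨X, hX⟩ := (exists_ind_iso_iff G.dual H).2 ⟨v, hv, hiso⟩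
      rcases hH with rfl | rfl
      · exact h X (Or.inl (Or.inr hX))
      · exact h X (Or.inr (Or.inr hX))
    rw [neutral_iff] at hn
    constructor
    · intro hab hac
      by_cases hbc : G.Arc b c
      · refine h1 peakD1 (Or.inl rfl) _ (inj hab.ne hac.ne hn.1) ?_
        unfold To at hab hac
        intro i j; fin_cases i <;> fin_cases j <;> simp [peakD1, ofRel, G.irrefl] <;> tauto
      · refine h1 peakD2 (Or.inr rfl) _ (inj hab.ne hac.ne hn.1) ?_
        unfold To at hab hac
        intro i j; fin_cases i <;> fin_cases j <;> simp [peakD2, ofRel, G.irrefl] <;> tauto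
    · intro hab hac
      by_cases hbc : G.Arc b c
      · refine h2 peakD1 (Or.inl rfl) _ (inj hab.ne.symm hac.ne.symm hn.1) ?_
        unfold To at hab hac
        intro i j; fin_cases i <;> fin_cases j <;>
          simp [peakD1, ofRel, dual, G.irrefl] <;> tauto
      · refine h2 peakD2 (Or.inr rfl) _ (inj hab.ne.symm hac.ne.symm hn.1) ?_
        unfold To at hab hac
        intro i j; fin_cases i <;> fin_cases j <;>
          simp [peakD2, ofRel, dual, G.irrefl] <;> tauto
  · intro h X hX
    have key : ∀ H : Dgraph (Fin 3), (H = peakD1 ∨ H = peakD2) →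
        ¬ (Iso (G.ind X) H ∨ Iso (G.ind X).dual H) := by
      rintro H hH hX
      rcases hX with hX | hX
      · obtain ⟨v, hv, hiso⟩ := (exists_ind_iso_iff G H).1 ⟨X, hX⟩
        refine (h (v 0) (v 1) (v 2) ?_).1 ?_ ?_
        · rw [neutral_iff, hiso, hiso]
          refine ⟨hv.ne (by decide), ?_⟩
          rcases hH with rfl | rfl <;> simp [peakD1, peakD2, ofRel]
        all_goals
          unfold To; rw [hiso, hiso]
          rcases hH with rfl | rfl <;> simp [peakD1, peakD2, ofRel]
      · obtain ⟨v, hv, hiso⟩ := (exists_ind_iso_iff G.dual H).1 ⟨X, hX⟩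
        simp only [dual] at hiso
        refine (h (v 0) (v 1) (v 2) ?_).2 ?_ ?_
        · rw [neutral_iff, hiso, hiso]
          refine ⟨hv.ne (by decide), ?_⟩
          rcases hH with rfl | rfl <;> simp [peakD1, peakD2, ofRel]
        all_goals
          unfold To; rw [hiso, hiso]
          rcases hH with rfl | rfl <;> simp [peakD1, peakD2, ofRel]
    rcases hX with hX | hX
    · exact key _ (Or.inl rfl) hX
    · exact key _ (Or.inr rfl) hX

theorem not_diamond_iff (G : Dgraph V) : (∀ X : Set V, ¬ IsDiamond (G.ind X)) ↔
    ∀ a b c d, G.To b c → G.To c d → G.To d b →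
      (G.To a b → G.To a c → ¬ G.To a d) ∧ (G.To b a → G.To c a → ¬ G.To d a) := by
  have inj : ∀ {a b c d : V}, a ≠ b → a ≠ c → a ≠ d → b ≠ c → b ≠ d → c ≠ d →
      Function.Injective ![a, b, c, d] := by
    intro a b c d h1 h2 h3 h4 h5 h6 i j
    fin_cases i <;> fin_cases j <;> simp [h1, h2, h3, h4, h5, h6, h1.symm, h2.symm, h3.symm,
      h4.symm, h5.symm, h6.symm]
  constructor
  · intro h a b c d hbc hcd hdb
    constructor
    · intro hab hac had
      obtain ⟨X, hX⟩ := (exists_ind_iso_iff G diamondD).2 ⟨_, inj hab.ne hac.ne had.ne hbc.ne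
        hdb.ne.symm hcd.ne, by
          unfold To at *
          intro i j
          fin_cases i <;> fin_cases j <;> simp [diamondD, ofRel, G.irrefl] <;> tauto⟩
      exact h X (Or.inl hX)
    · intro hab hac had
      obtain ⟨X, hX⟩ := (exists_ind_iso_iff G.dual diamondD).2 ⟨_, inj hab.ne.symm
        had.ne.symm hac.ne.symm hdb.ne.symm hbc.ne hcd.ne.symm, by
          unfold To at *
          intro i j
          fin_cases i <;> fin_cases j <;> simp [diamondD, ofRel, dual, G.irrefl] <;> tauto⟩
      exact h X (Or.inr hX)
  · intro h X hX
    rcases hX with hX | hX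
    · obtain ⟨v, hv, hiso⟩ := (exists_ind_iso_iff G diamondD).1 ⟨X, hX⟩
      refine (h (v 0) (v 1) (v 2) (v 3) ?_ ?_ ?_).1 ?_ ?_ ?_ <;>
      · unfold To; rw [hiso, hiso]; simp [diamondD, ofRel]
    · obtain ⟨v, hv, hiso⟩ := (exists_ind_iso_iff G.dual diamondD).1 ⟨X, hX⟩
      simp only [dual] at hiso
      refine (h (v 0) (v 1) (v 3) (v 2) ?_ ?_ ?_).2 ?_ ?_ ?_ <;>
      · unfold To; rw [hiso, hiso]; simp [diamondD, ofRel]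

theorem isPrechain_iff (G : Dgraph V) : G.IsPrechain ↔ Pre G := by
  unfold IsPrechain
  rw [not_peak_iff, not_diamond_iff]
  constructor
  · rintro ⟨h1, h2, h3⟩
    exact ⟨fun hn => (h1 _ _ _ hn).1, fun hn => (h1 _ _ _ hn).2,
      fun p q r => (h2 _ _ _ _ p q r).1, fun p q r => (h2 _ _ _ _ p q r).2,
      fun {x y z} p q => by_contra fun hne => h3 ⟨x, y, z, hne, p, q⟩⟩
  · intro h
    exact ⟨fun _ _ _ hn => ⟨h.out_peak hn, h.in_peak hn⟩,
      fun _ _ _ _ p q r => ⟨h.out_dia p q r, h.in_dia p q r⟩,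
      fun ⟨_, _, _, hne, p, q⟩ => hne (h.nn p q)⟩

theorem neutral_dual (G : Dgraph V) (x y : V) : G.dual.Neutral x y ↔ G.Neutral x y := by
  rw [neutral_iff, neutral_iff]
  exact and_congr_right fun _ => ⟨Iff.symm, Iff.symm⟩

theorem Pre.dual {G : Dgraph V} (h : Pre G) : Pre G.dual where
  out_peak hn := h.in_peak ((neutral_dual _ _ _).1 hn)
  in_peak hn := h.out_peak ((neutral_dual _ _ _).1 hn)
  out_dia p q r s t w := h.in_dia r q p s w t
  in_dia p q r s t w := h.out_dia r q p s w t
  nn p q := h.nn ((neutral_dual _ _ _).1 p) ((neutral_dual _ _ _).1 q)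

theorem LeHypo.restrict {k : ℕ} {G G' : Dgraph V} (h : LeHypo k G G') (C : Set V) :
    LeHypo k (G.ind C) (G'.ind C) := by
  intro j h1 h2 X hX hc
  have key : ∀ H : Dgraph V, Iso ((H.ind C).ind X) (H.ind (Subtype.val '' X)) := fun H =>
    ⟨Equiv.Set.image Subtype.val X Subtype.val_injective, fun x y => Iff.rfl⟩
  refine (key G).trans (Iso.trans (h j h1 h2 _ (hX.image _) ?_) (key G').symm)
  rw [Set.ncard_image_of_injective _ Subtype.val_injective, hc]

section Classes

variable {G G' : Dgraph V}

theorem DiffStep.ne {x y : V} (h : DiffStep G G' x y) : x ≠ y := by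
  rintro rfl
  have := G.irrefl x
  have := G'.irrefl x
  unfold DiffStep at h; tauto

theorem DiffStep.dir (h4 : LeHypo 4 G G') {x y : V} (h : DiffStep G G' x y) :
    G.To x y ∨ G.To y x := by
  rw [diffStep_iff h4] at h; tauto

theorem DiffStep.dual {x y : V} (h4 : LeHypo 4 G G') (h : DiffStep G G' x y) :
    DiffStep G.dual G'.dual x y := by
  have := h.symm h4
  exact this

theorem Neutral.not_diffStep (h4 : LeHypo 4 G G') {x y : V} (h : G.Neutral x y) :
    ¬ DiffStep G G' x y := fun h' => by
  have := h.not_to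
  have := h'.dir h4
  tauto

/-- Reversed directed pairs point the other way. -/
theorem To.rev (h4 : LeHypo 4 G G') {x y : V} (h : G.To x y) (hr : DiffStep G G' x y) :
    G'.To y x := by
  rw [diffStep_iff h4] at hr
  rcases hr with hr | hr
  · exact hr.2
  · exact absurd hr.1 h.asymm

theorem To.keep (h4 : LeHypo 4 G G') {x y : V} (h : G.To x y) (hr : ¬ DiffStep G G' x y) :
    G'.To x y :=
  ⟨(not_diffStep hr).1 h.1, fun h' => h.2 ((not_diffStep fun h'' => hr (h''.symm h4)).2 h')⟩

theorem Neutral.keep (h4 : LeHypo 4 G G') {x y : V} (h : G.Neutral x y) : G'.Neutral x y := by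
  have h1 := Dgraph.not_diffStep (h.not_diffStep h4)
  have h2 := Dgraph.not_diffStep (h.symm.not_diffStep h4)
  rw [neutral_iff] at *
  exact ⟨h.1, by rw [← h1, ← h2]; exact h.2⟩

/-- A vertex which is in no reversed pair with the ends of a reversed pair sees both ends in the
same way. -/
theorem uniform_step (h : LeHypo 4 G G') {a b c : V} (hab : DiffStep G G' a b)
    (hac : ¬ DiffStep G G' a c) (hbc : ¬ DiffStep G G' b c) (ha : a ≠ c) (hb : b ≠ c) :
    (G.Arc c a ↔ G.Arc c b) ∧ (G.Arc a c ↔ G.Arc b c) := by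
  have key : ∀ {a b}, G.To a b → DiffStep G G' a b → ¬ DiffStep G G' a c →
      ¬ DiffStep G G' b c → a ≠ c → b ≠ c →
      (G.Arc c a ↔ G.Arc c b) ∧ (G.Arc a c ↔ G.Arc b c) := by
    clear hab hac hbc ha hb a b
    intro a b t hab hac hbc ha hb
    have hba := hab.symm h
    have hca : ¬ DiffStep G G' c a := fun h' => hac (h'.symm h)
    have hcb : ¬ DiffStep G G' c b := fun h' => hbc (h'.symm h)
    rcases G.trichotomy ha with h1 | h1 | h1
    · rcases G.trichotomy hb with h2 | h2 | h2
      · have := h1.1; have := h1.2; have := h2.1; have := h2.2; tauto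
      · have := ((rev_trans h h1 h2 t).1 hab)
        tauto
      · rcases rev_neutral h hba h2 ha with h3 | h3
        · exact absurd h1 h3.1.not_to.1
        · exact absurd h3.1 hac
    · rcases G.trichotomy hb with h2 | h2 | h2
      · have := rev_cycle h t h2 h1 hab; tauto
      · have := h1.1; have := h1.2; have := h2.1; have := h2.2; tauto
      · rcases rev_neutral h hba h2 ha with h3 | h3
        · exact absurd h1 h3.1.not_to.2
        · exact absurd h3.1 hac
    · have := rev_neutral h hab h1 hb
      rw [neutral_iff] at *
      tauto
  rcases hab.dir h with t | t
  · exact key t hab hac hbc ha hb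
  · have := key t (hab.symm h) hbc hac hb ha; tauto

theorem diffRel_iff {x y : V} : DiffRel G G' x y ↔ Relation.ReflTransGen (DiffStep G G') x y := by
  rw [Relation.reflTransGen_iff_eq_or_transGen]; unfold DiffRel; tauto

theorem conn_closed {G G' : Dgraph V} {P : V → Prop}
    (hc : ∀ x y, Relation.ReflTransGen (DiffStep G G') x y)
    (hstep : ∀ x y, P x → DiffStep G G' x y → P y) {x : V} (hx : P x) (y : V) : P y := by
  induction hc x y with
  | refl => exact hx
  | tail _ hs ih => exact hstep _ _ ih hs

theorem diffClass_uniform (h : LeHypo 4 G G') {C : Set V} (hC : DiffClass G G' C) {a b c : V}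
    (ha : a ∈ C) (hb : b ∈ C) (hc : c ∉ C) :
    (G.Arc c a ↔ G.Arc c b) ∧ (G.Arc a c ↔ G.Arc b c) := by
  obtain ⟨x, rfl⟩ := hC
  simp only [Set.mem_ofPred_eq, diffRel_iff] at *
  have key : ∀ b, Relation.ReflTransGen (DiffStep G G') x b →
      (G.Arc c x ↔ G.Arc c b) ∧ (G.Arc x c ↔ G.Arc b c) := by
    intro b hb
    induction hb with
    | refl => simp
    | @tail y z hy hyz ih =>
      have := uniform_step h hyz (fun h' => hc (hy.tail h'))
        (fun h' => hc ((hy.tail hyz).tail h')) (by rintro rfl; exact hc hy)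
        (by rintro rfl; exact hc (hy.tail hyz))
      tauto
  have := key a ha
  have := key b hb
  tauto

theorem diffClass_interval (h : LeHypo 4 G G') {C : Set V} (hC : DiffClass G G' C) {I : Set C}
    (hI : (G.ind C).IsInterval I) : G.IsInterval (Subtype.val '' I) := by
  intro x hx
  by_cases hxC : x ∈ C
  · have := hI ⟨x, hxC⟩ (fun h' => hx ⟨_, h', rfl⟩)
    simp only [Set.forall_mem_image]
    exact this
  · have huni := fun a b ha hb => diffClass_uniform h hC (a := a) (b := b) (c := x) ha hb hxC
    simp only [Set.forall_mem_image]
    by_cases hne : ∃ a, a ∈ I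
    · obtain ⟨a, ha⟩ := hne
      have : ∀ b : C, _ := fun b => huni a b a.2 b.2
      by_cases h1 : G.Arc x a <;> by_cases h2 : G.Arc a x <;> simp_all
    · push Not at hne
      exact Or.inl fun y hy => absurd hy (hne y)

theorem diffClass_conn (h : LeHypo 4 G G') {C : Set V} (hC : DiffClass G G' C) (x y : C) :
    Relation.ReflTransGen (DiffStep (G.ind C) (G'.ind C)) x y := by
  obtain ⟨p, rfl⟩ := hC
  have key : ∀ b (hb : DiffRel G G' p b), Relation.ReflTransGen
      (DiffStep (G.ind {y | DiffRel G G' p y}) (G'.ind {y | DiffRel G G' p y}))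
      ⟨p, diffRel_iff.2 .refl⟩ ⟨b, hb⟩ := by
    intro b hb
    have hb' := diffRel_iff.1 hb
    induction hb' with
    | refl => exact .refl
    | @tail y z hy hyz ih => exact (ih (diffRel_iff.2 hy)).tail hyz
  refine Relation.ReflTransGen.trans ?_ (key y.1 y.2)
  have hs : Std.Symm (DiffStep (G.ind {y | DiffRel G G' p y})
    (G'.ind {y | DiffRel G G' p y})) := ⟨fun a b hab => hab.symm (h.restrict _)⟩
  exact symm (key x.1 x.2)

/-- No infinite interval induces a chain. -/
def NoInfChain (G : Dgraph V) : Prop :=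
  ∀ I : Set V, G.IsInterval I → (G.ind I).IsChainD → I.Finite

theorem noInfChain_of_class (h : LeHypo 4 G G') {C : Set V} (hC : DiffClass G G' C)
    (hG : ¬ G.CondCinf) : NoInfChain (G.ind C) := by
  intro I hI hchain
  by_contra hinf
  refine hG (Or.inl ⟨Subtype.val '' I, ?_, diffClass_interval h hC hI, ?_⟩)
  · exact Set.Infinite.image Subtype.val_injective.injOn hinf
  · refine ⟨?_, ?_⟩
    · rintro ⟨_, x, hx, rfl⟩ ⟨_, y, hy, rfl⟩ hxy
      exact hchain.1 ⟨x, hx⟩ ⟨y, hy⟩ (fun h' => hxy (Subtype.ext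
        (congrArg (fun z => z.1.1) h')))
    · rintro ⟨_, x, hx, rfl⟩ ⟨_, y, hy, rfl⟩ ⟨_, z, hz, rfl⟩ h1 h2
      exact hchain.2 ⟨x, hx⟩ ⟨y, hy⟩ ⟨z, hz⟩ h1 h2

end Classes

section FourRules

variable {G G' : Dgraph V}

theorem LeHypo.exists_perm_to {k : ℕ} (h : LeHypo k G G') {n : ℕ}
    (hn : 1 ≤ n) (hk : n ≤ k) (v : Fin n → V) (hv : Function.Injective v) :
    ∃ σ : Equiv.Perm (Fin n), ∀ i j, G.To (v i) (v j) ↔ G'.To (v (σ i)) (v (σ j)) := by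
  obtain ⟨σ, hσ⟩ := h.exists_perm hn hk v hv
  exact ⟨σ, fun i j => by unfold To; rw [hσ, hσ]⟩

/-- In a diamond the pairs at the apex are not reversed. -/
theorem diamond_rule (h : LeHypo 4 G G') {a b c d : V} (hbc : G.To b c) (hcd : G.To c d)
    (hdb : G.To d b) (hab : G.To a b) (hac : G.To a c) (had : G.To a d) :
    ¬ DiffStep G G' a b := by
  intro hr
  obtain ⟨σ, hσ⟩ := h.exists_perm_to (n := 4) (by norm_num) (by norm_num) ![a, b, c, d] (by
    intro i j; fin_cases i <;> fin_cases j <;>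
      simp [hab.ne, hac.ne, had.ne, hbc.ne, hcd.ne, hdb.ne, hab.ne.symm, hac.ne.symm,
        had.ne.symm, hbc.ne.symm, hcd.ne.symm, hdb.ne.symm])
  have h1 := (hσ 0 1).1 hab
  have h2 := (hσ 0 2).1 hac
  have h3 := (hσ 0 3).1 had
  have hba := hab.rev h hr
  have n1 : σ 0 ≠ σ 1 := by simp
  have n2 : σ 0 ≠ σ 2 := by simp
  have n3 : σ 0 ≠ σ 3 := by simp
  have n4 : σ 1 ≠ σ 2 := by simp
  have n5 : σ 1 ≠ σ 3 := by simp
  have n6 : σ 2 ≠ σ 3 := by simp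
  have cyc : (G'.To c b ∧ G'.To d c ∧ G'.To b d) ∨ (G'.To b c ∧ G'.To c d ∧ G'.To d b) := by
    by_cases h4 : DiffStep G G' b c
    · have := rev_cycle h hbc hcd hdb h4
      exact Or.inl ⟨hbc.rev h h4, hcd.rev h this.1, hdb.rev h this.2⟩
    · have h5 : ¬ DiffStep G G' c d := fun h' => h4 (rev_cycle h hcd hdb hbc h').2
      have h6 : ¬ DiffStep G G' d b := fun h' => h4 (rev_cycle h hdb hbc hcd h').1
      exact Or.inr ⟨hbc.keep h h4, hcd.keep h h5, hdb.keep h h6⟩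
  clear hσ
  have as : ∀ x y, G'.To x y → ¬ G'.To y x := fun x y => To.asymm
  generalize σ 0 = s0 at *
  generalize σ 1 = s1 at *
  generalize σ 2 = s2 at *
  generalize σ 3 = s3 at *
  fin_cases s0 <;> fin_cases s1 <;> fin_cases s2 <;> fin_cases s3 <;>
    simp at n1 n2 n3 n4 n5 n6 h1 h2 h3 <;> grind

theorem Q_rule (h : LeHypo 4 G G') {w y q r : V} (hq : G.Neutral w q) (hr : G.Neutral w r)
    (hqr : q ≠ r) (hyq : G.To y q) (hyr : G.To y r) (hwy : G.To w y)
    (h1 : DiffStep G G' w y) (h2 : DiffStep G G' y q) : ¬ DiffStep G G' y r := by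
  intro h3
  have k0 := hqr.symm
  obtain ⟨σ, hσ⟩ := h.exists_perm_to (n := 4) (by norm_num) (by norm_num) ![w, y, q, r] (by
    have := hq.1
    have := hr.1
    intro i j; fin_cases i <;> fin_cases j <;>
      simp [hq.1, hr.1, hyq.ne, hyr.ne, hwy.ne, hq.1.symm, hr.1.symm, hyq.ne.symm, hyr.ne.symm,
        hwy.ne.symm, hqr, k0])
  have a1 := (hσ 0 1).1 hwy
  have a2 := (hσ 1 2).1 hyq
  have a3 := (hσ 1 3).1 hyr
  have n1 : σ 0 ≠ σ 1 := by simp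
  have n2 : σ 0 ≠ σ 2 := by simp
  have n3 : σ 0 ≠ σ 3 := by simp
  have n4 : σ 1 ≠ σ 2 := by simp
  have n5 : σ 1 ≠ σ 3 := by simp
  have n6 : σ 2 ≠ σ 3 := by simp
  have b1 := hwy.rev h h1
  have b2 := hyq.rev h h2
  have b3 := hyr.rev h h3
  have b4 := (hq.keep h).not_to
  have b5 := (hr.keep h).not_to
  clear hσ
  have as : ∀ x y, G'.To x y → ¬ G'.To y x := fun x y => To.asymm
  generalize σ 0 = s0 at *
  generalize σ 1 = s1 at *
  generalize σ 2 = s2 at *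
  generalize σ 3 = s3 at *
  fin_cases s0 <;> fin_cases s1 <;> fin_cases s2 <;> fin_cases s3 <;>
    simp at n1 n2 n3 n4 n5 n6 a1 a2 a3 <;> grind

end FourRules

/-- Two `(≤4)`-hypomorphic digraphs with a single difference class. -/
structure Cls (G G' : Dgraph V) : Prop where
  hypo : LeHypo 4 G G'
  conn : ∀ x y, Relation.ReflTransGen (DiffStep G G') x y

section Prechains

variable {G G' : Dgraph V}

theorem Cls.dual (h : Cls G G') : Cls G.dual G'.dual where
  hypo := h.hypo.dual
  conn x y := (h.conn x y).lift id fun _ _ hab => DiffStep.dual h.hypo hab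

theorem DiffStep.undual {x y : V} (h4 : LeHypo 4 G G') (h : DiffStep G.dual G'.dual x y) :
    DiffStep G G' x y := DiffStep.symm h4 h

theorem flag_of_rev (h : LeHypo 4 G G') {x b c : V} (hbx : DiffStep G G' b x)
    (hbc : G.Neutral b c) (hxc : ¬ G.Neutral x c) (hne : x ≠ c) :
    DiffStep G G' x c ∧ ((G.To b x ∧ G.To x c) ∨ (G.To x b ∧ G.To c x)) := by
  rcases rev_neutral h hbx hbc hne with h1 | h1
  · exact absurd h1.1 hxc
  · exact h1

/-- If no two neutral pairs are adjacent, all directed pairs at a vertex of a neutral pair are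
reversed. -/
theorem neutral_rev (h : Cls G G')
    (nn : ∀ {x y z}, G.Neutral x y → G.Neutral x z → y = z) {b c : V}
    (hbc : G.Neutral b c) (z : V) : z = b ∨ z = c ∨ DiffStep G G' b z := by
  have h4 := h.hypo
  have F : ∀ {x}, DiffStep G G' b x →
      DiffStep G G' x c ∧ ((G.To b x ∧ G.To x c) ∨ (G.To x b ∧ G.To c x)) := fun {x} hx =>
    flag_of_rev h4 hx hbc (fun h' => hx.ne (nn hbc.symm h'.symm))
      (by rintro rfl; exact hbc.not_diffStep h4 hx)
  have F' : ∀ {x}, DiffStep G G' c x →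
      DiffStep G G' x b ∧ ((G.To c x ∧ G.To x b) ∨ (G.To x c ∧ G.To b x)) := fun {x} hx =>
    flag_of_rev h4 hx hbc.symm (fun h' => hx.ne (nn hbc h'.symm))
      (by rintro rfl; exact hbc.symm.not_diffStep h4 hx)
  exact conn_closed (P := fun z => z = b ∨ z = c ∨ DiffStep G G' b z) h.conn (by
    rintro x y hx hxy
    rcases hx with rfl | rfl | hx
    · exact Or.inr (Or.inr hxy)
    · exact Or.inr (Or.inr ((F' hxy).1.symm h4))
    · by_contra hy
      push Not at hy
      obtain ⟨hyb, hyc, hby⟩ := hy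
      have hcy : ¬ DiffStep G G' c y := fun h' => hby ((F' h').1.symm h4)
      have n1 : ¬ G.Neutral b y := fun h' => hyc (nn h' hbc)
      have n2 : ¬ G.Neutral c y := fun h' => hyb (nn h' hbc.symm)
      have key : ∀ {b c}, y ≠ b → y ≠ c → ¬ DiffStep G G' b y → ¬ DiffStep G G' c y →
          ¬ G.Neutral b y → ¬ G.Neutral c y → DiffStep G G' b x → DiffStep G G' x c →
          G.To b x → G.To x c → False := by
        intro b c hyb hyc hby hcy n1 n2 hx hxc tb tc
        have hyx := hxy.symm h4
        have hyb' : ¬ DiffStep G G' y b := fun h' => hby (h'.symm h4)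
        have hyc' : ¬ DiffStep G G' y c := fun h' => hcy (h'.symm h4)
        rcases hxy.dir h4 with t | t
        · rcases G.trichotomy hyb with t' | t' | t'
          · exact hyb' (rev_cycle h4 tb t t' hx).2
          · exact hby ((rev_trans h4 tb t t').2 hx hxy)
          · exact n1 t'.symm
        · rcases G.trichotomy hyc with t' | t' | t'
          · exact hyc' ((rev_trans h4 t tc t').2 hyx hxc)
          · exact hcy (rev_cycle h4 t tc t' hyx).2
          · exact n2 t'.symm
      have hF := F hx
      rcases hF.2 with t | t
      · exact key hyb hyc hby hcy n1 n2 hx hF.1 t.1 t.2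
      · exact key hyc hyb hcy hby n2 n1 (hF.1.symm h4) (hx.symm h4) t.2 t.1) (Or.inl rfl) z

theorem neutral_between (h : Cls G G')
    (nn : ∀ {x y z}, G.Neutral x y → G.Neutral x z → y = z) {b c z : V}
    (hbc : G.Neutral b c) (hb : z ≠ b) (hc : z ≠ c) : DiffStep G G' b z ∧ DiffStep G G' z c ∧
      ((G.To b z ∧ G.To z c) ∨ (G.To z b ∧ G.To c z)) := by
  have hr : DiffStep G G' b z := by
    have := neutral_rev h nn hbc z
    tauto
  exact ⟨hr, flag_of_rev h.hypo hr hbc (fun h' => hb (nn h'.symm hbc.symm)) hc⟩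

theorem no_out_peak (h : Cls G G')
    (nn : ∀ {x y z}, G.Neutral x y → G.Neutral x z → y = z) {a b c : V}
    (hbc : G.Neutral b c) (hab : G.To a b) (hac : G.To a c) : False := by
  rcases (neutral_between h nn hbc hab.ne hac.ne).2.2 with t | t
  · exact hab.asymm t.1
  · exact hac.asymm t.2

theorem no_out_diamond (h : Cls G G') {a b c d : V} (hbc : G.To b c) (hcd : G.To c d)
    (hdb : G.To d b) (hab : G.To a b) (hac : G.To a c) (had : G.To a d) : False := by
  have h4 := h.hypo
  have hstep : ∀ {t u v x}, G.To t u → G.To u v → G.To v t → G.To a t → G.To a u → G.To a v →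
      DiffStep G G' t x → ∃ t u v, G.To t u ∧ G.To u v ∧ G.To v t ∧ G.To a t ∧ G.To a u ∧
      G.To a v ∧ (x = t ∨ G.Neutral x t) := by
    intro t u v x htu huv hvt hat hau hav hx
    by_contra hcon
    have hT : ∀ t u v, G.To t u → G.To u v → G.To v t → G.To a t → G.To a u → G.To a v →
        x ≠ t ∧ ¬ G.Neutral x t := by
      intro t u v h1 h2 h3 h4 h5 h6
      refine ⟨fun h' => hcon ⟨t, u, v, h1, h2, h3, h4, h5, h6, Or.inl h'⟩,
        fun h' => hcon ⟨t, u, v, h1, h2, h3, h4, h5, h6, Or.inr h'⟩⟩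
    obtain ⟨e1, n1⟩ := hT t u v htu huv hvt hat hau hav
    obtain ⟨e2, n2⟩ := hT u v t huv hvt htu hau hav hat
    obtain ⟨e3, n3⟩ := hT v t u hvt htu huv hav hat hau
    have r1 := diamond_rule h4 htu huv hvt hat hau hav
    have r2 := diamond_rule h4 huv hvt htu hau hav hat
    have r3 := diamond_rule h4 hvt htu huv hav hat hau
    have r1' : ¬ DiffStep G G' t a := fun h' => r1 (h'.symm h4)
    have hxt := hx.symm h4
    have hxa : x ≠ a := by rintro rfl; exact r1 hxt
    have t1 := G.trichotomy e1
    have t2 := G.trichotomy e2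
    have t3 := G.trichotomy e3
    have hax : G.To a x := by
      rcases G.trichotomy hxa with h1 | h1 | h1
      · exfalso
        have hxat : DiffStep G G' x a := by
          rcases t1 with h2 | h2 | h2
          · have := (rev_trans h4 h1 hat h2).1 hxt
            tauto
          · have := (rev_cycle h4 h2 h1 hat hx); tauto
          · exact absurd h2 n1
        have aux : ∀ {s}, G.To a s → ¬ DiffStep G G' a s → ¬ G.To s x := fun hs hns hsx =>
          hns (rev_cycle h4 h1 hs hsx hxat).1
        have := aux hat r1
        have := aux hau r2
        have := aux hav r3
        have := diamond_rule h4 htu huv hvt (a := x)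
        tauto
      · exact h1
      · rcases rev_neutral h4 hxt h1 hat.ne.symm with h2 | h2
        · exact absurd hat h2.1.not_to.2
        · exact absurd h2.1 r1'
    have d1 : ¬ (G.To x t ∧ G.To x u ∧ G.To x v) := fun h' =>
      diamond_rule h4 htu huv hvt h'.1 h'.2.1 h'.2.2 hxt
    have d2 : ¬ (G.To t x ∧ G.To u x ∧ G.To v x) := fun h' =>
      diamond_rule h4.dual (G := G.dual) (G' := G'.dual) (a := x) (b := t) (c := v) (d := u)
        hvt huv htu h'.1 h'.2.2 h'.2.1 (hxt.dual h4)
    have c1 : ∀ i j, G.To x i → G.To i j → G.To j x → G.To a i → G.To a j → False :=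
      fun i j h1 h2 h3 h4 h5 => (hT x i j h1 h2 h3 hax h4 h5).1 rfl
    clear hcon hT
    rcases t1 with t1 | t1 | t1 <;> rcases t2 with t2 | t2 | t2 <;>
      rcases t3 with t3 | t3 | t3 <;>
      first
      | exact n1 t1
      | exact n2 t2
      | exact n3 t3
      | exact d1 ⟨t1, t2, t3⟩
      | exact d2 ⟨t1, t2, t3⟩
      | exact c1 t u t1 htu t2 hat hau
      | exact c1 u v t2 huv t3 hau hav
      | exact c1 v t t3 hvt t1 hav hat
  have := conn_closed (P := fun x => ∃ t u v, G.To t u ∧ G.To u v ∧ G.To v t ∧ G.To a t ∧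
      G.To a u ∧ G.To a v ∧ (x = t ∨ G.Neutral x t)) h.conn (by
    rintro z x ⟨t, u, v, htu, huv, hvt, hat, hau, hav, rfl | hz⟩ hzx
    · exact hstep htu huv hvt hat hau hav hzx
    · by_cases hxt : x = t
      · exact ⟨t, u, v, htu, huv, hvt, hat, hau, hav, Or.inl hxt⟩
      · rcases rev_neutral h4 hzx hz hxt with h1 | h1
        · exact ⟨t, u, v, htu, huv, hvt, hat, hau, hav, Or.inr h1.1⟩
        · exact hstep htu huv hvt hat hau hav (h1.1.symm h4)) (x := b)
    ⟨b, c, d, hbc, hcd, hdb, hab, hac, had, Or.inl rfl⟩ a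
  obtain ⟨t, u, v, -, -, -, hat, -, -, rfl | hn⟩ := this
  · exact hat.ne rfl
  · exact hn.not_to.1 hat

/-- A single difference class without adjacent neutral pairs is a prechain. -/
theorem Cls.pre (h : Cls G G') (nn : ∀ {x y z}, G.Neutral x y → G.Neutral x z → y = z) :
    Pre G where
  out_peak := no_out_peak h nn
  in_peak hn h1 h2 := no_out_peak h.dual
    (fun p q => nn ((neutral_dual _ _ _).1 p) ((neutral_dual _ _ _).1 q))
    ((neutral_dual _ _ _).2 hn) h1 h2
  out_dia := no_out_diamond h
  in_dia {_ b c d} p q r s t w := no_out_diamond h.dual (b := b) (c := d) (d := c) r q p s w t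
  nn := nn

end Prechains

section Good

variable {G G' : Dgraph V}

/-- Three pairwise directed vertices with at least two reversed pairs. -/
def Good (G G' : Dgraph V) (t u v : V) : Prop :=
  G.Dir t u ∧ G.Dir u v ∧ G.Dir t v ∧
    ((DiffStep G G' t u ∧ DiffStep G G' t v) ∨ (DiffStep G G' t u ∧ DiffStep G G' u v) ∨
      (DiffStep G G' t v ∧ DiffStep G G' u v))

theorem Dir.symm {x y : V} (h : G.Dir x y) : G.Dir y x := by unfold Dir at *; tauto

theorem Dir.ne {x y : V} (h : G.Dir x y) : x ≠ y := by
  rcases h with h | h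
  · exact To.ne h
  · exact (To.ne h).symm

theorem Dir.not_neutral {x y : V} (h : G.Dir x y) : ¬ G.Neutral x y := fun h' => h'.2 h

theorem DiffStep.isDir (h4 : LeHypo 4 G G') {x y : V} (h : DiffStep G G' x y) : G.Dir x y :=
  h.dir h4

theorem Good.swap (h4 : LeHypo 4 G G') {t u v : V} (h : Good G G' t u v) : Good G G' u t v := by
  obtain ⟨h1, h2, h3, h5⟩ := h
  have := @DiffStep.symm _ G G' h4 t u
  exact ⟨h1.symm, h3, h2, by tauto⟩

theorem Good.swap_right (h4 : LeHypo 4 G G') {t u v : V} (h : Good G G' t u v) :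
    Good G G' t v u := by
  obtain ⟨h1, h2, h3, h5⟩ := h
  have := @DiffStep.symm _ G G' h4 u v
  exact ⟨h3, h2.symm, h1, by tauto⟩

theorem Q_rule_both (h : LeHypo 4 G G') {w y q r : V} (hq : G.Neutral w q) (hr : G.Neutral w r)
    (hqr : q ≠ r) (h1 : DiffStep G G' w y) (h2 : DiffStep G G' y q) (h3 : DiffStep G G' y r) :
    False := by
  have k1 := flag_of_rev h h1 hq (h2.isDir h).not_neutral h2.ne
  have k2 := flag_of_rev h h1 hr (h3.isDir h).not_neutral h3.ne
  rcases k1.2 with k | k <;> rcases k2.2 with k' | k'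
  · exact Q_rule h hq hr hqr k.2 k'.2 k.1 h1 h2 h3
  · exact k.1.asymm k'.1
  · exact k.1.asymm k'.1
  · exact Q_rule h.dual ((neutral_dual _ _ _).2 hq) ((neutral_dual _ _ _).2 hr) hqr k.2 k'.2 k.1
      (h1.dual h) (h2.dual h) (h3.dual h)

theorem Good.not_neutral_two_aux (h : LeHypo 4 G G') {t u v y : V} (hT : Good G G' t u v)
    (hu : G.Neutral y u) (hv : G.Neutral y v) (ht : ¬ G.Neutral y t) : False := by
  have ht' : ¬ G.Neutral t y := fun h' => ht h'.symm
  have hyt : t ≠ y := by rintro rfl; exact hT.1.not_neutral hu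
  have key : ∀ {u v}, G.Dir t u → G.Dir t v → u ≠ v → DiffStep G G' t u → G.Neutral y u →
      G.Neutral y v → False := by
    intro u v d1 d2 huv hr hu hv
    have h1 := (flag_of_rev h (hr.symm h) hu.symm ht' hyt).1
    have h2 := (flag_of_rev h (h1.symm h) hv d2.not_neutral d2.ne).1
    exact Q_rule_both h hu hv huv (h1.symm h) hr h2
  obtain ⟨h1, h2, h3, h5⟩ := hT
  rcases h5 with h5 | h5 | h5
  · exact key h1 h3 h2.ne h5.1 hu hv
  · exact key h1 h3 h2.ne h5.1 hu hv
  · exact key h3 h1 h2.ne.symm h5.1 hv hu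

theorem Good.not_neutral_all (h : Cls G G') {t u v w : V} (hT : Good G G' t u v)
    (ht : G.Neutral w t) (hu : G.Neutral w u) (hv : G.Neutral w v) : False := by
  have h4 := h.hypo
  have := conn_closed (P := fun w => G.Neutral w t ∧ G.Neutral w u ∧ G.Neutral w v) h.conn (by
    rintro w y ⟨ht, hu, hv⟩ hwy
    have q : ∀ {s}, G.Neutral w s → DiffStep G G' y s ∨ G.Neutral y s := by
      intro s hs
      have hne : y ≠ s := by rintro rfl; exact hs.not_diffStep h4 hwy
      have := rev_neutral h4 hwy hs hne
      tauto
    have q1 := q ht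
    have q2 := q hu
    have q3 := q hv
    have r1 := Q_rule_both h4 ht hu hT.1.ne hwy
    have r2 := Q_rule_both h4 hu hv hT.2.1.ne hwy
    have r3 := Q_rule_both h4 ht hv hT.2.2.1.ne hwy
    have s1 := hT.not_neutral_two_aux h4 (y := y)
    have s2 := (hT.swap h4).not_neutral_two_aux h4 (y := y)
    have s3 := ((hT.swap_right h4).swap h4).not_neutral_two_aux h4 (y := y)
    tauto) (x := w) ⟨ht, hu, hv⟩ t
  exact this.1.1 rfl

theorem Good.not_neutral_two (h : Cls G G') {t u v y : V} (hT : Good G G' t u v)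
    (hu : G.Neutral y u) (hv : G.Neutral y v) : False := by
  by_cases ht : G.Neutral y t
  · exact hT.not_neutral_all h ht hu hv
  · exact hT.not_neutral_two_aux h.hypo hu hv ht

theorem Good.cover (h : Cls G G') {t u v : V} (hT : Good G G' t u v) (x : V) :
    ∃ t u v, Good G G' t u v ∧ (x = t ∨ G.Neutral x t) := by
  have h4 := h.hypo
  have hstep : ∀ {t u v x}, Good G G' t u v → DiffStep G G' t x →
      ∃ t u v, Good G G' t u v ∧ (x = t ∨ G.Neutral x t) := by
    intro t u v x hT hx
    by_contra hcon
    push Not at hcon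
    have c2 := hcon _ _ _ (hT.swap h4)
    have c3 := hcon _ _ _ ((hT.swap_right h4).swap h4)
    have d2 := G.trichotomy c2.1
    have d3 := G.trichotomy c3.1
    have e : ∀ {i}, DiffStep G G' t i → G.Dir x i → False := fun {i} hti hxi =>
      (hcon x t i ⟨((hx.symm h4).isDir h4), hti.isDir h4, hxi, Or.inr (Or.inl
        ⟨hx.symm h4, hti⟩)⟩).1 rfl
    have e2 := e (i := u)
    have e3 := e (i := v)
    have h5 := hT.2.2.2
    simp only [dir_iff] at e2 e3
    tauto
  refine conn_closed (P := fun x => ∃ t u v, Good G G' t u v ∧ (x = t ∨ G.Neutral x t)) h.conn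
    ?_ (x := t) ⟨t, u, v, hT, Or.inl rfl⟩ x
  rintro z x ⟨t, u, v, hT, rfl | hz⟩ hzx
  · exact hstep hT hzx
  · by_cases hxt : x = t
    · exact ⟨t, u, v, hT, Or.inl hxt⟩
    · rcases rev_neutral h4 hzx hz hxt with h1 | h1
      · exact ⟨t, u, v, hT, Or.inr h1.1⟩
      · exact hstep hT (h1.1.symm h4)

theorem Good.cover' (h : Cls G G') {t u v : V} (hT : Good G G' t u v) (x : V) :
    ∃ u v, Good G G' x u v := by
  have h4 := h.hypo
  obtain ⟨t, i, j, hT, rfl | hz⟩ := hT.cover h x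
  · exact ⟨_, _, hT⟩
  · have key : ∀ {i j}, Good G G' t i j → DiffStep G G' t i → ∃ u v, Good G G' x u v := by
      intro i j hT hti
      have ni : ¬ G.Neutral i x := fun h' => (hT.swap_right h4).swap h4 |>.not_neutral_two h
        hz h'.symm
      have nj : ¬ G.Neutral x j := fun h' => (hT.swap h4).not_neutral_two h hz h'
      have hix : i ≠ x := by rintro rfl; exact hT.1.symm.not_neutral hz
      have hxj : x ≠ j := by rintro rfl; exact hT.2.2.1.symm.not_neutral hz
      have dj : G.Dir x j := by
        have := G.trichotomy hxj
        rw [dir_iff]; tauto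
      have rix := (flag_of_rev h4 hti hz.symm ni hix).1
      have rxi := rix.symm h4
      by_cases hij : DiffStep G G' i j
      · exact ⟨i, j, rxi.isDir h4, hT.2.1, dj, Or.inr (Or.inl ⟨rxi, hij⟩)⟩
      · have htj : DiffStep G G' t j := by have := hT.2.2.2; tauto
        have rxj := ((flag_of_rev h4 htj hz.symm (fun h' => nj h'.symm) hxj.symm).1).symm h4
        exact ⟨i, j, rxi.isDir h4, hT.2.1, dj, Or.inl ⟨rxi, rxj⟩⟩
    rcases hT.2.2.2 with h5 | h5 | h5
    · exact key hT h5.1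
    · exact key hT h5.1
    · exact key (hT.swap_right h4) h5.1

theorem Good.nn (h : Cls G G') {t u v : V} (hT : Good G G' t u v) {x y z : V}
    (hy : G.Neutral x y) (hz : G.Neutral x z) : y = z := by
  have h4 := h.hypo
  by_contra hyz
  obtain ⟨i, j, hT⟩ := hT.cover' h x
  have key : ∀ {i j}, Good G G' x i j → DiffStep G G' x i → False := by
    intro i j hT hxi
    have n : ∀ {y}, G.Neutral x y → ¬ G.Neutral i y := fun {y} hy h' =>
      ((hT.swap_right h4).swap h4).not_neutral_two h hy.symm h'.symm
    have e : ∀ {y}, G.Neutral x y → i ≠ y := by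
      rintro y hy rfl; exact hy.not_diffStep h4 hxi
    have f1 := flag_of_rev h4 hxi hy (n hy) (e hy)
    have f2 := flag_of_rev h4 hxi hz (n hz) (e hz)
    have d : G.Dir y z := by
      rcases G.trichotomy hyz with h1 | h1 | h1
      · exact Or.inl h1
      · exact Or.inr h1
      · exfalso
        have := (flag_of_rev h4 (f1.1.symm h4) h1 (f2.1.isDir h4).not_neutral f2.1.ne).2
        have a1 := fun h => @To.asymm _ G x i h
        have a2 := fun h => @To.asymm _ G y i h
        have a3 := fun h => @To.asymm _ G z i h
        tauto
    have hG : Good G G' i y z := ⟨f1.1.isDir h4, d, f2.1.isDir h4, Or.inl ⟨f1.1, f2.1⟩⟩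
    exact hG.not_neutral_two h hy hz
  rcases hT.2.2.2 with h5 | h5 | h5
  · exact key hT h5.1
  · exact key hT h5.1
  · exact key (hT.swap_right h4) h5.1

end Good

section Paths

variable {G G' : Dgraph V}

/-- Reversed arcs. -/
def Sc (G G' : Dgraph V) (x y : V) : Prop := DiffStep G G' x y ∧ G.To x y

theorem rev_rev (h : LeHypo 4 G G') (hg : ∀ t u v, ¬ Good G G' t u v) {a b c : V}
    (hab : DiffStep G G' a b) (hbc : DiffStep G G' b c) (hac : a ≠ c) :
    G.Neutral a c ∧ ((G.To a b ∧ G.To b c) ∨ (G.To b a ∧ G.To c b)) := by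
  have hn : G.Neutral a c := ⟨hac, fun hd => hg a b c
    ⟨hab.isDir h, hbc.isDir h, hd, Or.inr (Or.inl ⟨hab, hbc⟩)⟩⟩
  exact ⟨hn, (flag_of_rev h hab hn (hbc.isDir h).not_neutral hbc.ne).2⟩

theorem Sc.inj_right (h : LeHypo 4 G G') (hg : ∀ t u v, ¬ Good G G' t u v) {x y z : V}
    (hy : Sc G G' x y) (hz : Sc G G' x z) : y = z := by
  by_contra hne
  rcases (rev_rev h hg (hy.1.symm h) hz.1 hne).2 with t | t
  · exact hy.2.asymm t.1
  · exact hz.2.asymm t.2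

theorem Sc.inj_left (h : LeHypo 4 G G') (hg : ∀ t u v, ¬ Good G G' t u v) {x y z : V}
    (hy : Sc G G' y x) (hz : Sc G G' z x) : y = z := by
  by_contra hne
  rcases (rev_rev h hg hy.1 (hz.1.symm h) hne).2 with t | t
  · exact hz.2.asymm t.2
  · exact hy.2.asymm t.1

theorem sc_of_rev (h : LeHypo 4 G G') {x y : V} (hr : DiffStep G G' x y) :
    Sc G G' x y ∨ Sc G G' y x := by
  rcases hr.dir h with t | t
  · exact Or.inl ⟨hr, t⟩
  · exact Or.inr ⟨hr.symm h, t⟩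

theorem neutral_of_not_rev (h : Cls G G') (hg : ∀ t u v, ¬ Good G G' t u v) {x y : V}
    (hxy : x ≠ y) (hr : ¬ DiffStep G G' x y) : G.Neutral x y := by
  have := conn_closed (P := fun y => y = x ∨ DiffStep G G' x y ∨ G.Neutral x y) h.conn (by
    rintro y z hy hyz
    by_cases hzx : z = x
    · exact Or.inl hzx
    rcases hy with rfl | hy | hy
    · exact Or.inr (Or.inl hyz)
    · exact Or.inr (Or.inr (rev_rev h.hypo hg hy hyz (Ne.symm hzx)).1)
    · rcases rev_neutral h.hypo hyz hy.symm hzx with h1 | h1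
      · exact Or.inr (Or.inr h1.1.symm)
      · exact Or.inr (Or.inl (h1.1.symm h.hypo))) (Or.inl rfl) y
  rcases this with h1 | h1 | h1
  · exact absurd h1.symm hxy
  · exact absurd h1 hr
  · exact h1

theorem arc_move (h : Cls G G') {x y z : V}
    (hxy : G.Neutral x y) (hyz : DiffStep G G' y z) (hzx : z ≠ x) (hr : ¬ DiffStep G G' z x) :
    G.Neutral x z ∧ (G.Arc x y ↔ G.Arc x z) := by
  rcases rev_neutral h.hypo hyz hxy.symm hzx with h1 | h1
  · exact ⟨h1.1.symm, h1.2⟩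
  · exact absurd h1.1 hr

theorem selfDual_of_four (a b c d : V) (hV : ∀ x, x = a ∨ x = b ∨ x = c ∨ x = d)
    (hab : G.To a b) (hbc : G.To b c) (hcd : G.To c d) (hda : G.To d a)
    (hac : G.Neutral a c) (hbd : G.Neutral b d) : SelfDual G := by
  classical
  have ea : Equiv.swap b d a = a := Equiv.swap_apply_of_ne_of_ne hab.ne hda.ne.symm
  have ec : Equiv.swap b d c = c := Equiv.swap_apply_of_ne_of_ne hbc.ne.symm hcd.ne
  have eb : Equiv.swap b d b = d := Equiv.swap_apply_left b d
  have ed : Equiv.swap b d d = b := Equiv.swap_apply_right b d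
  refine ⟨Equiv.swap b d, fun x y => ?_⟩
  rw [neutral_iff] at hac hbd
  unfold To at *
  change G.Arc x y ↔ G.Arc _ _
  rcases hV x with rfl | rfl | rfl | rfl <;> rcases hV y with rfl | rfl | rfl | rfl <;>
    simp only [ea, eb, ec, ed, G.irrefl] <;> tauto

theorem selfDual_of_perm (h : Cls G G') (hg : ∀ t u v, ¬ Good G G' t u v) (σ : Equiv.Perm V)
    (hσ : ∀ x, Sc G G' x (σ x)) (v₀ : V) : SelfDual G := by
  have h4 := h.hypo
  have hsc : ∀ {x y}, Sc G G' x y → y = σ x := fun hxy => Sc.inj_right h4 hg hxy (hσ _)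
  by_cases hinv : ∀ x y, G.Arc x y ↔ G.Arc (σ x) (σ y)
  · have hz : ∀ (n : ℤ) x y, G.Arc x y ↔ G.Arc ((σ ^ n) x) ((σ ^ n) y) := by
      intro n
      induction n using Int.induction_on with
      | zero => intro x y; simp
      | succ n ih => intro x y; rw [hinv, ih, zpow_add_one]; rfl
      | pred n ih =>
        intro x y
        rw [hinv (((σ ^ (-(n : ℤ) - 1)) x)), ih x y]
        have : ∀ x, σ ((σ ^ (-(n : ℤ) - 1)) x) = (σ ^ (-(n : ℤ))) x := fun x => by
          rw [← Equiv.Perm.mul_apply, ← zpow_one_add]; congr 2; ring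
        rw [this, this]
    have hsurj : ∀ y, ∃ n : ℤ, (σ ^ n) v₀ = y := by
      refine conn_closed h.conn ?_ (x := v₀) ⟨0, rfl⟩
      rintro x y ⟨n, rfl⟩ hxy
      rcases sc_of_rev h4 hxy with hs | hs
      · exact ⟨1 + n, by rw [hsc hs, zpow_one_add]; rfl⟩
      · have := hsc hs
        refine ⟨-1 + n, ?_⟩
        rw [zpow_add, Equiv.Perm.mul_apply, this]; simp
    have hwd : ∀ n m : ℤ, (σ ^ n) v₀ = (σ ^ m) v₀ → (σ ^ (-n)) v₀ = (σ ^ (-m)) v₀ := by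
      intro n m hnm
      have := congrArg (σ ^ (-n - m)) hnm
      rw [← Equiv.Perm.mul_apply, ← Equiv.Perm.mul_apply, ← zpow_add, ← zpow_add] at this
      have e1 : -n - m + n = -m := by ring
      have e2 : -n - m + m = -n := by ring
      rw [e1, e2] at this
      exact this.symm
    choose N hN using hsurj
    have hφ : ∀ n : ℤ, (σ ^ (-N ((σ ^ n) v₀))) v₀ = (σ ^ (-n)) v₀ := fun n => hwd _ _ (hN _)
    let φ : V → V := fun x => (σ ^ (-N x)) v₀
    have hinvol : Function.Involutive φ := by
      intro x
      change (σ ^ (-N ((σ ^ (-N x)) v₀))) v₀ = x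
      rw [hφ, neg_neg, hN]
    refine ⟨hinvol.toPerm φ, fun x y => ?_⟩
    change G.Arc x y ↔ G.Arc ((σ ^ (-N y)) v₀) ((σ ^ (-N x)) v₀)
    rw [hz (N x + N y) ((σ ^ (-N y)) v₀), ← Equiv.Perm.mul_apply, ← Equiv.Perm.mul_apply,
      ← zpow_add, ← zpow_add]
    have e1 : N x + N y + -N y = N x := by ring
    have e2 : N x + N y + -N x = N y := by ring
    rw [e1, e2, hN, hN]
  · push Not at hinv
    obtain ⟨x, y, hxy⟩ := hinv
    have hbad : ¬ (G.Arc x y ↔ G.Arc (σ x) (σ y)) := by tauto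
    have hne : x ≠ y := by
      rintro rfl; have := G.irrefl x; have := G.irrefl (σ x); tauto
    have n1 : y ≠ σ x := by
      rintro rfl; have := (hσ x).2.1; have := (hσ (σ x)).2.1; tauto
    have n2 : x ≠ σ y := by
      rintro rfl; have := (hσ y).2.2; have := (hσ (σ y)).2.2; tauto
    have nr : ∀ {x y}, y ≠ σ x → x ≠ σ y → ¬ DiffStep G G' x y := fun h1 h2 hr =>
      (sc_of_rev h4 hr).elim (fun hs => h1 (hsc hs)) fun hs => h2 (hsc hs)
    have hn : G.Neutral x y := neutral_of_not_rev h hg hne (nr n1 n2)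
    have hrσ : ¬ DiffStep G G' (σ x) (σ y) := nr (fun h' => n1 (σ.injective h'))
      fun h' => n2 (σ.injective h')
    have hneσ : σ x ≠ σ y := fun h' => hne (σ.injective h')
    have e1 : x = σ (σ y) := by
      by_contra hc
      have r1 : ¬ DiffStep G G' (σ y) x := nr hc (fun h' => hne (σ.injective h').symm)
      have m1 := arc_move h hn (hσ y).1 n2.symm r1
      have m2 := arc_move h m1.1.symm (hσ x).1 hneσ hrσ
      exact hbad (m1.2.trans (((neutral_iff _ _ _).1 m1.1).2.trans
        (m2.2.trans ((neutral_iff _ _ _).1 m2.1).2)))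
    have e2 : y = σ (σ x) := by
      by_contra hc
      have r1 : ¬ DiffStep G G' (σ x) y := nr hc (fun h' => hne (σ.injective h'))
      have m1 := arc_move h hn.symm (hσ x).1 n1.symm r1
      have m2 := arc_move h m1.1.symm (hσ y).1 hneσ.symm fun h' => hrσ (h'.symm h4)
      exact hbad (((neutral_iff _ _ _).1 hn).2.trans (m1.2.trans
        (((neutral_iff _ _ _).1 m1.1).2.trans m2.2)))
    have t1 := (hσ x).2
    have t2 := (hσ (σ x)).2
    have t3 := (hσ y).2
    have t4 := (hσ (σ y)).2
    rw [← e2] at t2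
    rw [← e1] at t4
    refine selfDual_of_four x (σ x) y (σ y) ?_ t1 t2 t3 t4 hn
      (neutral_of_not_rev h hg hneσ hrσ)
    have p1 := (hσ x).1
    refine conn_closed h.conn ?_ (x := x) (Or.inl rfl)
    intro u w hu huw
    rcases sc_of_rev h4 huw with hs | hs
    · have := hsc hs
      rcases hu with rfl | rfl | rfl | rfl <;> grind
    · have := hsc hs
      have hh : ∀ {p}, u = σ p → w = p := fun h' => σ.injective (this.symm.trans h')
      rcases hu with hu | hu | hu | hu
      · rw [e1] at hu; have := hh hu; tauto
      · have := hh hu; tauto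
      · rw [e2] at hu; have := hh hu; tauto
      · have := hh hu; tauto

theorem path_of_source (h : Cls G G') (hg : ∀ t u v, ¬ Good G G' t u v) {v₀ : V}
    (hv₀ : ∀ x, ¬ Sc G G' x v₀) :
    SelfDual G ∨ ∃ full, Iso G (consecNat full) := by
  classical
  have h4 := h.hypo
  let s : V → V := fun x => if hx : ∃ y, Sc G G' x y then hx.choose else x
  have hs : ∀ x, (∃ y, Sc G G' x y) → Sc G G' x (s x) := by
    intro x hx
    simp only [s, dif_pos hx]
    exact hx.choose_spec
  let f : ℕ → V := fun n => s^[n] v₀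
  let D : ℕ → Prop := fun n => ∀ m < n, ∃ y, Sc G G' (f m) y
  have hDm : ∀ {m n}, m ≤ n → D n → D m := fun hmn hn k hk => hn k (hk.trans_le hmn)
  have hD0 : D 0 := fun m hm => absurd hm (Nat.not_lt_zero m)
  have hstep : ∀ {n}, D (n + 1) → Sc G G' (f n) (f (n + 1)) := by
    intro n hn
    have : f (n + 1) = s (f n) := Function.iterate_succ_apply' s n v₀
    rw [this]
    exact hs _ (hn n (Nat.lt_succ_self n))
  have hinj : ∀ i j, D i → D j → f i = f j → i = j := by
    intro i
    induction i with
    | zero =>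
      intro j _ hj hij
      cases j with
      | zero => rfl
      | succ j => exact absurd (hij ▸ hstep hj : Sc G G' (f j) (f 0)) (hv₀ _)
    | succ i ih =>
      intro j hi hj hij
      cases j with
      | zero => exact absurd (hij ▸ hstep hi : Sc G G' (f i) (f 0)) (hv₀ _)
      | succ j =>
        have := Sc.inj_left h4 hg (hstep hi) (hij ▸ hstep hj)
        rw [ih j (hDm (Nat.le_succ i) hi) (hDm (Nat.le_succ j) hj) this]
  have hsurj : ∀ y, ∃ n, D n ∧ f n = y := by
    refine conn_closed h.conn ?_ (x := v₀) ⟨0, hD0, rfl⟩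
    rintro x y ⟨n, hn, rfl⟩ hxy
    rcases sc_of_rev h4 hxy with hs | hs
    · have hn1 : D (n + 1) := by
        intro m hm
        rcases Nat.lt_succ_iff_lt_or_eq.1 hm with hm | rfl
        · exact hn m hm
        · exact ⟨y, hs⟩
      exact ⟨n + 1, hn1, Sc.inj_right h4 hg (hstep hn1) hs⟩
    · cases n with
      | zero => exact absurd hs (hv₀ _)
      | succ n => exact ⟨n, hDm (Nat.le_succ n) hn, Sc.inj_left h4 hg (hstep hn) hs⟩
  have hadj : ∀ {i j}, D i → D j → DiffStep G G' (f i) (f j) → i + 1 = j ∨ j + 1 = i := by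
    have key : ∀ {i j}, D i → D j → Sc G G' (f i) (f j) → i + 1 = j := by
      intro i j hi hj hij
      have hi1 : D (i + 1) := by
        intro m hm
        rcases Nat.lt_succ_iff_lt_or_eq.1 hm with hm | rfl
        · exact hi m hm
        · exact ⟨_, hij⟩
      exact hinj _ _ hi1 hj (Sc.inj_right h4 hg (hstep hi1) hij)
    intro i j hi hj hij
    rcases sc_of_rev h4 hij with hs | hs
    · exact Or.inl (key hi hj hs)
    · exact Or.inr (key hj hi hs)
  have hneu : ∀ {i j}, D j → i + 1 < j → G.Neutral (f i) (f j) := by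
    intro i j hj hij
    have hi := hDm (show i ≤ j by omega) hj
    refine neutral_of_not_rev h hg (fun h' => ?_) (fun h' => ?_)
    · have := hinj _ _ hi hj h'; omega
    · have := hadj hi hj h'; omega
  have hT1 : ∀ k i, D (i + 2 + k) → (G.Arc (f i) (f (i + 2 + k)) ↔ G.Arc (f i) (f (i + 2))) := by
    intro k i
    induction k with
    | zero => intro _; rfl
    | succ k ih =>
      intro hk
      have hk' := hDm (Nat.le_succ _) hk
      rw [← ih hk']
      have hn := hneu hk (show i + 1 < i + 2 + (k + 1) by omega)
      exact (arc_move h (hneu hk' (show i + 1 < i + 2 + k by omega)) (hstep hk).1 hn.1.symm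
        (hn.symm.not_diffStep h4)).2.symm
  have hT2 : ∀ i, D (i + 2) → (G.Arc (f i) (f (i + 2)) ↔ G.Arc (f 0) (f 2)) := by
    intro i
    induction i with
    | zero => intro _; rfl
    | succ i ih =>
      intro hi
      rw [← ih (hDm (by omega) hi), ← hT1 1 i (hDm (by omega) hi)]
      have n1 := hneu hi (show i + 1 < i + 1 + 2 by omega)
      have n2 := hneu hi (show i + 1 + 1 < i + 1 + 2 by omega)
      have := (arc_move h n1.symm (hstep (n := i) (hDm (by omega) hi)).1 n2.1
        (n2.not_diffStep h4)).2
      rw [neutral_iff] at n1 n2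
      change G.Arc (f (i + 1)) (f (i + 1 + 2)) ↔ G.Arc (f i) (f (i + 1 + 2))
      tauto
  have hT : ∀ {i j}, D j → i + 1 < j → (G.Arc (f i) (f j) ↔ G.Arc (f 0) (f 2)) := by
    intro i j hj hij
    obtain ⟨k, rfl⟩ := Nat.exists_eq_add_of_le (show i + 2 ≤ j by omega)
    rw [hT1 k i hj, hT2 i (hDm (by omega) hj)]
  obtain ⟨full, hfull⟩ : ∃ full : Bool, full = true ↔ G.Arc (f 0) (f 2) := by
    by_cases hf : G.Arc (f 0) (f 2)
    · exact ⟨true, by simp [hf]⟩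
    · exact ⟨false, by simp [hf]⟩
  have harc : ∀ i j, D i → D j → (G.Arc (f i) (f j) ↔
      i ≠ j ∧ (i + 1 = j ∨ (full = true ∧ (i + 1 < j ∨ j + 1 < i)))) := by
    intro i j hi hj
    rcases lt_trichotomy i j with hij | rfl | hij
    · rcases (show i + 1 = j ∨ i + 1 < j by omega) with rfl | hij'
      · have := (hstep hj).2.1
        simp [this]
      · have := hT hj hij'
        rw [this, hfull]
        constructor
        · intro h'; exact ⟨by omega, Or.inr ⟨h', Or.inl hij'⟩⟩
        · rintro ⟨-, h' | h'⟩
          · omega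
          · exact h'.1
    · simp [G.irrefl]
    · rcases (show j + 1 = i ∨ j + 1 < i by omega) with rfl | hij'
      · have := (hstep hi).2.2
        refine iff_of_false this ?_
        rintro ⟨-, h' | h'⟩ <;> omega
      · have h1 := hT hi hij'
        have h2 := (neutral_iff _ _ _).1 (hneu hi hij')
        rw [← h2.2, h1, hfull]
        constructor
        · intro h'; exact ⟨by omega, Or.inr ⟨h', Or.inr hij'⟩⟩
        · rintro ⟨-, h' | h'⟩
          · omega
          · exact h'.1
  by_cases hall : ∀ n, D n
  · right
    let e : ℕ ≃ V := Equiv.ofBijective f ⟨fun i j => hinj i j (hall i) (hall j), fun y => by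
      obtain ⟨n, -, hn⟩ := hsurj y; exact ⟨n, hn⟩⟩
    refine ⟨full, Iso.symm ⟨e, fun i j => ?_⟩⟩
    exact (harc i j (hall i) (hall j)).symm
  · left
    push Not at hall
    have hN := Nat.find_spec hall
    have hmin : ∀ {m}, m < Nat.find hall → D m := fun hm => by
      by_contra hc; exact Nat.find_min hall hm hc
    generalize Nat.find hall = n₀ at *
    have hlt : ∀ {m}, D m → m < n₀ := fun {m} hm => by
      by_contra hc; exact hN (hDm (by omega) hm)
    choose N hND hN' using hsurj
    have hNf : ∀ {n}, n < n₀ → N (f n) = n := fun hn => hinj _ _ (hND _) (hmin hn) (hN' _)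
    have hinvol : Function.Involutive (fun x => f (n₀ - 1 - N x)) := by
      intro x
      have := hlt (hND x)
      simp only
      rw [hNf (by omega)]
      have e : n₀ - 1 - (n₀ - 1 - N x) = N x := by omega
      rw [e, hN']
    refine ⟨hinvol.toPerm, fun x y => ?_⟩
    change G.Arc x y ↔ G.Arc (f (n₀ - 1 - N y)) (f (n₀ - 1 - N x))
    have hx := hlt (hND x)
    have hy := hlt (hND y)
    rw [harc _ _ (hmin (by omega)) (hmin (by omega))]
    conv_lhs => rw [← hN' x, ← hN' y]
    rw [harc _ _ (hND x) (hND y)]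
    have a1 : n₀ - 1 - N y ≠ n₀ - 1 - N x ↔ N x ≠ N y := by omega
    have a2 : n₀ - 1 - N y + 1 = n₀ - 1 - N x ↔ N x + 1 = N y := by omega
    have a3 : n₀ - 1 - N y + 1 < n₀ - 1 - N x ↔ N x + 1 < N y := by omega
    have a4 : n₀ - 1 - N x + 1 < n₀ - 1 - N y ↔ N y + 1 < N x := by omega
    rw [a1, a2, a3, a4]

theorem SelfDual.of_dual (h : SelfDual G.dual) : SelfDual G := Iso.dual h

theorem Good.of_dual (h : LeHypo 4 G G') {t u v : V} (hg : Good G.dual G'.dual t u v) :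
    Good G G' t u v := by
  obtain ⟨h1, h2, h3, h5⟩ := hg
  have := @DiffStep.undual _ G G' t u h
  have := @DiffStep.undual _ G G' t v h
  have := @DiffStep.undual _ G G' u v h
  exact ⟨h1.symm, h2.symm, h3.symm, by tauto⟩

/-- A single difference class with two adjacent neutral pairs is self-dual or a one-end infinite
consecutivity. -/
theorem Cls.consecutivity (h : Cls G G') {x y z : V} (hxy : G.Neutral x y) (hxz : G.Neutral x z)
    (hyz : y ≠ z) : SelfDual G ∨ G.OneEndInfiniteConsecutivity := by
  have h4 := h.hypo
  have hg : ∀ t u v, ¬ Good G G' t u v := fun t u v hT => hyz (hT.nn h hxy hxz)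
  by_cases h1 : ∃ v₀, ∀ x, ¬ Sc G G' x v₀
  · obtain ⟨v₀, hv⟩ := h1
    rcases path_of_source h hg hv with h2 | ⟨full, h2⟩
    · exact Or.inl h2
    · exact Or.inr ⟨full, Or.inl h2⟩
  by_cases h2 : ∃ v₀, ∀ x, ¬ Sc G G' v₀ x
  · obtain ⟨v₀, hv⟩ := h2
    have := path_of_source (v₀ := v₀) h.dual (fun t u v hT => hg t u v (hT.of_dual h4))
      fun x hx => hv x ⟨(hx.1.undual h4).symm h4, hx.2⟩
    rcases this with h2 | ⟨full, h2⟩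
    · exact Or.inl h2.of_dual
    · exact Or.inr ⟨full, Or.inr h2.dual⟩
  push Not at h1 h2
  choose s hs using h2
  have hb : Function.Bijective s := by
    refine ⟨fun a b hab => Sc.inj_left h4 hg (hs a) (hab ▸ hs b), fun y => ?_⟩
    obtain ⟨x, hx⟩ := h1 y
    exact ⟨x, Sc.inj_right h4 hg (hs x) hx⟩
  exact Or.inl (selfDual_of_perm h hg (Equiv.ofBijective s hb) hs x)

end Paths

section Chains

/-- Elementwise form of intervals inducing a chain. -/
structure ChainInt (G : Dgraph V) (I : Set V) : Prop where
  uni : ∀ w ∉ I, ∀ y ∈ I, ∀ z ∈ I, (G.Arc w y ↔ G.Arc w z) ∧ (G.Arc y w ↔ G.Arc z w)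
  dir : ∀ y ∈ I, ∀ z ∈ I, y ≠ z → G.Dir y z
  acyc : ∀ x ∈ I, ∀ y ∈ I, ∀ z ∈ I, G.To x y → G.To y z → ¬ G.To z x

theorem isInterval_iff (G : Dgraph V) (I : Set V) : G.IsInterval I ↔
    ∀ w ∉ I, ∀ y ∈ I, ∀ z ∈ I, (G.Arc w y ↔ G.Arc w z) ∧ (G.Arc y w ↔ G.Arc z w) := by
  constructor
  · intro h w hw y hy z hz
    rcases h w hw with h | h | h | h
    all_goals
      have := h y hy
      have := h z hz
      tauto
  · intro h w hw
    by_cases hne : ∃ a, a ∈ I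
    · obtain ⟨a, ha⟩ := hne
      have := fun z hz => h w hw a ha z hz
      by_cases h1 : G.Arc w a <;> by_cases h2 : G.Arc a w <;> simp_all
    · push Not at hne
      exact Or.inl fun y hy => absurd hy (hne y)

theorem isChainD_of {G : Dgraph V} (h1 : ∀ x y, x ≠ y → G.Dir x y)
    (h2 : ∀ x y z, G.To x y → G.To y z → ¬ G.To z x) : G.IsChainD := by
  refine ⟨h1, fun x y z hxy hyz => ?_⟩
  have a1 : G.To x y := by
    rcases h1 x y (by rintro rfl; exact G.irrefl _ hxy) with h | h
    · exact h
    · exact absurd hxy h.2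
  have a2 : G.To y z := by
    rcases h1 y z (by rintro rfl; exact G.irrefl _ hyz) with h | h
    · exact h
    · exact absurd hyz h.2
  have hne : x ≠ z := by rintro rfl; exact a1.asymm a2
  rcases h1 x z hne with h | h
  · exact h.1
  · exact absurd h (h2 x y z a1 a2)

theorem ChainInt.isChainD {G : Dgraph V} {I : Set V} (h : ChainInt G I) : (G.ind I).IsChainD :=
  isChainD_of (fun x y hxy => h.dir x x.2 y y.2 fun h' => hxy (Subtype.ext h'))
    fun x y z => h.acyc x x.2 y y.2 z z.2

theorem ChainInt.finite {G : Dgraph V} {I : Set V} (h : ChainInt G I) (hG : NoInfChain G) :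
    I.Finite := hG I ((isInterval_iff G I).2 h.uni) h.isChainD

theorem ChainInt.dual {G : Dgraph V} {I : Set V} (h : ChainInt G I) : ChainInt G.dual I where
  uni w hw y hy z hz := (h.uni w hw y hy z hz).symm
  dir y hy z hz hne := (h.dir y hy z hz hne).symm
  acyc x hx y hy z hz h1 h2 h3 := h.acyc z hz y hy x hx h2 h1 h3

theorem ChainInt.uni_to {G : Dgraph V} {I : Set V} (h : ChainInt G I) {w y z : V} (hw : w ∉ I)
    (hy : y ∈ I) (hz : z ∈ I) : (G.To w y ↔ G.To w z) ∧ (G.To y w ↔ G.To z w) := by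
  have := h.uni w hw y hy z hz
  unfold To; tauto

theorem ChainInt.union {G : Dgraph V} {I J : Set V} (hI : ChainInt G I) (hJ : ChainInt G J)
    {o : V} (hoI : o ∈ I) (hoJ : o ∈ J) : ChainInt G (I ∪ J) where
  uni := by
    have key : ∀ w ∉ I ∪ J, ∀ y ∈ I ∪ J, (G.Arc w y ↔ G.Arc w o) ∧ (G.Arc y w ↔ G.Arc o w) := by
      rintro w hw y (hy | hy)
      · exact hI.uni w (fun h => hw (Or.inl h)) y hy o hoI
      · exact hJ.uni w (fun h => hw (Or.inr h)) y hy o hoJ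
    intro w hw y hy z hz
    have := key w hw y hy
    have := key w hw z hz
    tauto
  dir := by
    have key : ∀ y ∈ I, ∀ z ∈ J, y ≠ z → G.Dir y z := by
      intro y hy z hz hne
      by_cases hyJ : y ∈ J
      · exact hJ.dir y hyJ z hz hne
      · have h1 := hJ.uni y hyJ o hoJ z hz
        have h2 := hI.dir y hy o hoI (by rintro rfl; exact hyJ hoJ)
        unfold Dir at *; tauto
    rintro y (hy | hy) z (hz | hz) hne
    · exact hI.dir y hy z hz hne
    · exact key y hy z hz hne
    · exact (key z hz y hy hne.symm).symm
    · exact hJ.dir y hy z hz hne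
  acyc := by
    have key : ∀ {I : Set V}, ChainInt G I → ∀ x ∈ I, ∀ y ∈ I, ∀ z, G.To x y → G.To y z →
        ¬ G.To z x := by
      intro I hI x hx y hy z h1 h2 h3
      by_cases hz : z ∈ I
      · exact hI.acyc x hx y hy z hz h1 h2 h3
      · exact h2.asymm ((hI.uni_to hz hx hy).1.1 h3)
    rintro x hx y hy z hz h1 h2 h3
    rcases hx with hx | hx <;> rcases hy with hy | hy <;> rcases hz with hz | hz <;>
      first
      | exact key hI x hx y hy z h1 h2 h3
      | exact key hJ x hx y hy z h1 h2 h3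
      | exact key hI y hy z hz x h2 h3 h1
      | exact key hJ y hy z hz x h2 h3 h1
      | exact key hI z hz x hx y h3 h1 h2
      | exact key hJ z hz x hx y h3 h1 h2

theorem chain_iso_fin {G : Dgraph V} [Finite V] (hG : G.IsChainD) :
    Iso G (⟨fun i j => i < j, fun i => lt_irrefl i⟩ : Dgraph (Fin (Nat.card V))) := by
  classical
  have := Fintype.ofFinite V
  have : IsStrictTotalOrder V G.Arc :=
    { irrefl := G.irrefl
      trans := hG.2
      trichotomous := fun a b h1 h2 => by
        by_contra hne
        rcases hG.1 a b hne with h | h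
        · exact h1 h.1
        · exact h2 h.1 }
  let _ : LinearOrder V := linearOrderOfSTO G.Arc
  let e := Fintype.orderIsoFinOfCardEq V (Nat.card_eq_fintype_card (α := V)).symm
  exact Iso.symm ⟨e.toEquiv, fun x y => (e.lt_iff_lt (x := x) (y := y)).symm⟩

theorem chain_iso {G H : Dgraph V} [Finite V] (hG : G.IsChainD) (hH : H.IsChainD) : Iso G H :=
  (chain_iso_fin hG).trans (chain_iso_fin hH).symm

theorem IsChainD.dual {G : Dgraph V} (hG : G.IsChainD) : G.dual.IsChainD :=
  ⟨fun x y h => Dir.symm (hG.1 x y h), fun x y z h1 h2 => hG.2 z y x h2 h1⟩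

theorem glue {Q : Type*} {G H : Dgraph V} (f : V → Q)
    (hcl : ∀ q, Iso (G.ind {x | f x = q}) (H.ind {x | f x = q}))
    (hoff : ∀ x y, f x ≠ f y → (G.Arc x y ↔ H.Arc x y))
    (huni : ∀ x x' y y', f x = f x' → f y = f y' → f x ≠ f y → (G.Arc x y ↔ G.Arc x' y')) :
    Iso G H := by
  choose e he using hcl
  let φ : V → V := fun x => (e (f x) ⟨x, rfl⟩).1
  let ψ : V → V := fun x => ((e (f x)).symm ⟨x, rfl⟩).1
  have hφ : ∀ x, f (φ x) = f x := fun x => (e (f x) ⟨x, rfl⟩).2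
  have hψ : ∀ x, f (ψ x) = f x := fun x => ((e (f x)).symm ⟨x, rfl⟩).2
  have hφq : ∀ x q (hx : f x = q), φ x = (e q ⟨x, hx⟩).1 := by rintro x _ rfl; rfl
  have hψq : ∀ x q (hx : f x = q), ψ x = ((e q).symm ⟨x, hx⟩).1 := by rintro x _ rfl; rfl
  refine ⟨⟨φ, ψ, fun x => ?_, fun x => ?_⟩, fun x y => ?_⟩
  · rw [hψq (φ x) (f x) (hφ x)]
    have : (⟨φ x, hφ x⟩ : {z | f z = f x}) = e (f x) ⟨x, rfl⟩ := Subtype.ext rfl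
    rw [this, Equiv.symm_apply_apply]
  · rw [hφq (ψ x) (f x) (hψ x)]
    have : (⟨ψ x, hψ x⟩ : {z | f z = f x}) = (e (f x)).symm ⟨x, rfl⟩ := Subtype.ext rfl
    rw [this, Equiv.apply_symm_apply]
  · change G.Arc x y ↔ H.Arc (φ x) (φ y)
    by_cases hxy : f x = f y
    · rw [hφq x (f y) hxy]
      exact he (f y) ⟨x, hxy⟩ ⟨y, rfl⟩
    · rw [← hoff _ _ (by rw [hφ, hφ]; exact hxy)]
      exact huni _ _ _ _ (hφ x).symm (hφ y).symm hxy

/-- A digraph with an anti-automorphism outside a finite chain interval is self-dual. -/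
theorem selfDual_of_chainInt {G : Dgraph V} {I : Set V} (hI : ChainInt G I) (hfin : I.Finite)
    (τ : V ≃ V) (hτ : ∀ x ∈ I, τ x = x)
    (h : ∀ x y, ¬ (x ∈ I ∧ y ∈ I) → (G.Arc x y ↔ G.Arc (τ y) (τ x))) : SelfDual G := by
  classical
  let H : Dgraph V := ⟨fun x y => G.Arc (τ y) (τ x), fun x => G.irrefl _⟩
  refine Iso.trans (glue (H := H) (fun x => if x ∈ I then none else some x) ?_ ?_ ?_)
    ⟨τ, fun x y => Iff.rfl⟩
  · intro q
    cases q with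
    | none =>
      have e : {x | (if x ∈ I then none else some x) = none} = I := by
        ext x; simp
      rw [e]
      have := hfin.to_subtype
      have hH : H.ind I = (G.ind I).dual := by
        unfold ind Dgraph.dual
        congr 1
        funext x y
        change G.Arc (τ y) (τ x) = G.Arc y x
        rw [hτ x x.2, hτ y y.2]
      rw [hH]
      exact chain_iso hI.isChainD hI.isChainD.dual
    | some q =>
      refine ⟨Equiv.refl _, ?_⟩
      rintro ⟨x, hx⟩ ⟨y, hy⟩
      have hxq : x = q := by
        simp only [Set.mem_ofPred_eq] at hx
        split_ifs at hx; exact Option.some.inj hx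
      have hyq : y = q := by
        simp only [Set.mem_ofPred_eq] at hy
        split_ifs at hy; exact Option.some.inj hy
      subst hxq
      subst hyq
      exact iff_of_false (G.irrefl _) (H.irrefl _)
  · intro x y hxy
    exact h x y fun h' => hxy (by simp [h'.1, h'.2])
  · intro x x' y y' hx hy hxy
    by_cases h1 : x ∈ I
    · have h2 : x' ∈ I := by by_contra hc; simp [h1, hc] at hx
      have h3 : y ∉ I := fun hc => hxy (by simp [h1, hc])
      have h4 : y' = y := by
        by_cases h4 : y' ∈ I
        · simp [h3, h4] at hy
        · simpa [h3, h4, eq_comm] using hy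
      rw [h4]
      exact (hI.uni y h3 x h1 x' h2).2
    · have h2 : x' = x := by
        by_cases h4 : x' ∈ I
        · simp [h1, h4] at hx
        · simpa [h1, h4, eq_comm] using hx
      rw [h2]
      by_cases h3 : y ∈ I
      · have h4 : y' ∈ I := by by_contra hc; simp [h3, hc] at hy
        exact (hI.uni x h1 y h3 y' h4).1
      · have h4 : y' = y := by
          by_cases h4 : y' ∈ I
          · simp [h3, h4] at hy
          · simpa [h3, h4, eq_comm] using hy
        rw [h4]

theorem selfDual_of_chain {G : Dgraph V} (hG : G.IsChainD) (hN : NoInfChain G) : SelfDual G := by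
  have hun : (G.ind Set.univ).IsChainD := by
    refine ⟨fun x y hxy => hG.1 x y fun h' => hxy (Subtype.ext h'), fun x y z => hG.2 x y z⟩
  have := Set.finite_univ_iff.1 (hN Set.univ (fun x hx => absurd trivial hx) hun)
  exact chain_iso hG hG.dual

theorem LeHypo.iso_of_card {k : ℕ} {G G' : Dgraph V} (h : LeHypo k G G') [Finite V]
    (hk : Nat.card V ≤ k) [Nonempty V] : Iso G G' := by
  have key : ∀ H : Dgraph V, Iso (H.ind Set.univ) H := fun H =>
    ⟨Equiv.Set.univ V, fun x y => Iff.rfl⟩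
  refine (key G).symm.trans (Iso.trans (h (Nat.card V) Nat.card_pos hk _ Set.finite_univ ?_)
    (key G'))
  exact Set.ncard_univ V

theorem LeHypo.symm {k : ℕ} {G G' : Dgraph V} (h : LeHypo k G G') : LeHypo k G' G :=
  fun j h1 h2 X hX hc => (h j h1 h2 X hX hc).symm

end Chains

section Dual

variable {G G' : Dgraph V}

/-- In a prechain which is a single difference class all 3-cycles are reversed. -/
theorem cycle_rev (h : Cls G G') (hp : Pre G) {i j p : V} (hij : G.To i j) (hjp : G.To j p)
    (hpi : G.To p i) : DiffStep G G' i j := by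
  have h4 := h.hypo
  by_contra hr
  have := conn_closed (P := fun z => G.To j z ∧ G.To z i) h.conn (by
    rintro z w ⟨hjz, hzi⟩ hzw
    have r1 : ¬ DiffStep G G' j z := fun h' => hr (rev_cycle h4 hjz hzi hij h').2
    have r2 : ¬ DiffStep G G' z i := fun h' => hr (rev_cycle h4 hzi hij hjz h').1
    have hwi : w ≠ i := by rintro rfl; exact r2 hzw
    have hwj : w ≠ j := by rintro rfl; exact r1 (hzw.symm h4)
    have n1 : ¬ G.Neutral w i := fun h' => by
      rcases rev_neutral h4 (hzw.symm h4) h' hzi.ne with h1 | h1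
      · exact h1.1.not_to.1 hzi
      · exact r2 h1.1
    have n2 : ¬ G.Neutral w j := fun h' => by
      rcases rev_neutral h4 (hzw.symm h4) h' hjz.ne.symm with h1 | h1
      · exact h1.1.not_to.2 hjz
      · exact r1 (h1.1.symm h4)
    have c1 : G.To i w → G.To w z → False := fun a b =>
      r2 (rev_cycle h4 b hzi a (hzw.symm h4)).1
    have c2 : G.To j w → G.To i w → G.To z w → False := fun a b c =>
      hp.in_dia hij hjz hzi b a c
    have c3 : G.To w j → G.To z w → False := fun a b => r1 (rev_cycle h4 b a hjz hzw).2
    have c4 : G.To w j → G.To w i → G.To w z → False := fun a b c =>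
      hp.out_dia hij hjz hzi b a c
    have d1 := G.trichotomy hwi
    have d2 := G.trichotomy hwj
    have d3 := hzw.dir h4
    clear r1 r2 hr
    tauto) (x := p) ⟨hjp, hpi⟩ i
  exact hij.asymm this.1

/-- In a prechain which is a single difference class, a directed pair which is not reversed lies
in a chain interval. -/
theorem chainInt_of_not_rev (h : Cls G G') (hp : Pre G) {x y : V} (hxy : G.To x y)
    (hr : ¬ DiffStep G G' x y) : ∃ I, ChainInt G I ∧ x ∈ I ∧ y ∈ I := by
  have h4 := h.hypo
  have nx : ∀ z, ¬ G.Neutral x z := fun z hn => by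
    rcases neutral_rev h hp.nn hn y with h1 | h1 | h1
    · exact hxy.ne h1.symm
    · rw [h1] at hxy; exact hn.not_to.1 hxy
    · exact hr h1
  have ny : ∀ z, ¬ G.Neutral y z := fun z hn => by
    rcases neutral_rev h hp.nn hn x with h1 | h1 | h1
    · exact hxy.ne h1
    · rw [h1] at hxy; exact hn.not_to.2 hxy
    · exact hr (h1.symm h4)
  have hcyc : ∀ z, G.To y z → ¬ G.To z x := fun z h1 h2 => hr (cycle_rev h hp hxy h1 h2)
  have hxo : ∀ z, z ≠ x → G.To x z ∨ G.To z x := fun z hz => by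
    have := G.trichotomy hz; have := fun h : G.Neutral z x => nx z h.symm; tauto
  have hyo : ∀ z, z ≠ y → G.To y z ∨ G.To z y := fun z hz => by
    have := G.trichotomy hz; have := fun h : G.Neutral z y => ny z h.symm; tauto
  have hbet : ∀ z z', G.To x z → G.To z y → G.To x z' → G.To z' y → z ≠ z' → G.Dir z z' := by
    intro z z' h1 h2 h3 h5 hne
    rcases G.trichotomy hne with h' | h' | h'
    · exact Or.inl h'
    · exact Or.inr h'
    · exact absurd h3 (hp.out_peak h' h1)
  have hout : ∀ w, w ≠ x → w ≠ y → ¬ (G.To x w ∧ G.To w y) →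
      (G.To w x ∧ G.To w y) ∨ (G.To x w ∧ G.To y w) := by
    intro w h1 h2 h3
    have := hxo w h1
    have := hyo w h2
    have := hcyc w
    tauto
  refine ⟨{z | z = x ∨ z = y ∨ (G.To x z ∧ G.To z y)}, ⟨?_, ?_, ?_⟩, Or.inl rfl,
    Or.inr (Or.inl rfl)⟩
  · have key : ∀ w, ¬ (w = x ∨ w = y ∨ (G.To x w ∧ G.To w y)) → ∀ z,
        (z = x ∨ z = y ∨ (G.To x z ∧ G.To z y)) →
        (G.Arc w z ↔ G.Arc w x) ∧ (G.Arc z w ↔ G.Arc x w) := by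
      intro w hw z hz
      push Not at hw
      rcases hout w hw.1 hw.2.1 (fun h' => hw.2.2 h'.1 h'.2) with ⟨a, b⟩ | ⟨a, b⟩
      · rcases hz with rfl | rfl | ⟨c, d⟩
        · simp
        · have := a.1; have := a.2; have := b.1; have := b.2; tauto
        · have hwz : w ≠ z := by rintro rfl; exact hw.2.2 c d
          have e : G.To w z := by
            rcases G.trichotomy hwz with h' | h' | h'
            · exact h'
            · exact absurd hxy (fun _ => hp.in_dia c h' a hxy d b)
            · exact absurd d (hp.in_peak h' b)
          have := a.1; have := a.2; have := e.1; have := e.2; tauto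
      · rcases hz with rfl | rfl | ⟨c, d⟩
        · simp
        · have := a.1; have := a.2; have := b.1; have := b.2; tauto
        · have hwz : w ≠ z := by rintro rfl; exact hw.2.2 c d
          have e : G.To z w := by
            rcases G.trichotomy hwz with h' | h' | h'
            · exact absurd hxy (fun _ => hp.out_dia d b h' c hxy a)
            · exact h'
            · exact absurd c (hp.out_peak h' a)
          have := a.1; have := a.2; have := e.1; have := e.2; tauto
    intro w hw u hu z hz
    have := key w hw u hu
    have := key w hw z hz
    tauto
  · rintro u hu z hz hne
    rcases hu with rfl | rfl | ⟨a, b⟩ <;> rcases hz with rfl | rfl | ⟨c, d⟩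
    · exact absurd rfl hne
    · exact Or.inl hxy
    · exact Or.inl c
    · exact Or.inr hxy
    · exact absurd rfl hne
    · exact Or.inr d
    · exact Or.inr a
    · exact Or.inl b
    · exact hbet _ _ a b c d hne
  · have as : ∀ u v, G.To u v → ¬ G.To v u := fun u v => To.asymm
    rintro u hu v hv w hw h1 h2 h3
    rcases hu with rfl | rfl | ⟨a, b⟩ <;> rcases hv with rfl | rfl | ⟨c, d⟩ <;>
      rcases hw with rfl | rfl | ⟨e, f⟩ <;>
      first
      | exact as _ _ h1 h1
      | exact as _ _ h2 h2
      | exact as _ _ h3 h3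
      | exact as _ _ h1 ‹_›
      | exact as _ _ h2 ‹_›
      | exact as _ _ h3 ‹_›
      | exact hp.out_dia h1 h2 h3 a c e

/-- A prechain which is a single difference class is reversed, up to isomorphism. -/
theorem dual_iso (h : Cls G G') (hp : Pre G) (hN : NoInfChain G) : Iso G.dual G' := by
  have h4 := h.hypo
  let K : V → Set V := fun x => {y | ∃ I, ChainInt G I ∧ x ∈ I ∧ y ∈ I}
  have hrefl : ∀ x, x ∈ K x := fun x => ⟨{x}, ⟨by
    rintro w hw _ rfl _ rfl; simp, by
    rintro _ rfl _ rfl hne; exact absurd rfl hne, by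
    rintro _ rfl _ rfl _ rfl h1 h2 h3; exact h1.asymm h1⟩, rfl, rfl⟩
  have hsym : ∀ {x y}, y ∈ K x → x ∈ K y := fun ⟨I, h1, h2, h3⟩ => ⟨I, h1, h3, h2⟩
  have htrans : ∀ {x y z}, y ∈ K x → z ∈ K y → z ∈ K x := fun ⟨I, h1, h2, h3⟩ ⟨J, g1, g2, g3⟩ =>
    ⟨I ∪ J, h1.union g1 h3 g2, Or.inl h2, Or.inr g3⟩
  have hKeq : ∀ {x y}, K x = K y ↔ y ∈ K x := by
    intro x y
    constructor
    · intro he; rw [he]; exact hrefl y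
    · intro hy
      ext z
      exact ⟨fun hz => htrans (hsym hy) hz, fun hz => htrans hy hz⟩
  have hKint : ∀ x, ChainInt G (K x) := by
    intro x
    refine ⟨?_, ?_, ?_⟩
    · have key : ∀ w ∉ K x, ∀ y ∈ K x, (G.Arc w y ↔ G.Arc w x) ∧ (G.Arc y w ↔ G.Arc x w) := by
        rintro w hw y ⟨I, h1, h2, h3⟩
        exact h1.uni w (fun hwI => hw ⟨I, h1, h2, hwI⟩) y h3 x h2
      intro w hw y hy z hz
      have := key w hw y hy
      have := key w hw z hz
      tauto
    · rintro y ⟨I, h1, h2, h3⟩ z ⟨J, g1, g2, g3⟩ hne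
      exact (h1.union g1 h2 g2).dir y (Or.inl h3) z (Or.inr g3) hne
    · rintro y ⟨I, h1, h2, h3⟩ z ⟨J, g1, g2, g3⟩ w ⟨L, l1, l2, l3⟩
      exact ((h1.union g1 h2 g2).union l1 (Or.inl h2) l2).acyc y (Or.inl (Or.inl h3)) z
        (Or.inl (Or.inr g3)) w (Or.inr l3)
  refine glue K ?_ ?_ ?_
  · intro q
    have hsub : ∀ {x y : V}, K x = q → K y = q → y ∈ K x := fun hx hy => hKeq.1 (hx.trans hy.symm)
    have : Finite {x | K x = q} := by
      by_cases hq : ∃ x, K x = q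
      · obtain ⟨x, hx⟩ := hq
        exact (((hKint x).finite hN).subset fun y hy => hsub hx hy).to_subtype
      · push Not at hq
        have : IsEmpty {x | K x = q} := ⟨fun x => hq x.1 x.2⟩
        infer_instance
    refine chain_iso (isChainD_of ?_ ?_) (isChainD_of ?_ ?_)
    · rintro ⟨x, hx⟩ ⟨y, hy⟩ hne
      exact (hKint x).dual.dir x (hrefl x) y (hsub hx hy) fun h' => hne (Subtype.ext h')
    · rintro ⟨x, hx⟩ ⟨y, hy⟩ ⟨z, hz⟩
      exact (hKint x).dual.acyc x (hrefl x) y (hsub hx hy) z (hsub hx hz)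
    · rintro ⟨x, hx⟩ ⟨y, hy⟩ hne
      have hd := (hKint x).dir x (hrefl x) y (hsub hx hy) fun h' => hne (Subtype.ext h')
      have := pair_rule h4 hd.ne
      unfold Dir at hd
      change (G'.Arc x y ∧ ¬ G'.Arc y x) ∨ (G'.Arc y x ∧ ¬ G'.Arc x y)
      tauto
    · rintro ⟨x, hx⟩ ⟨y, hy⟩ ⟨z, hz⟩ h1 h2 h3
      have h1 : G'.To x y := h1
      have h2 : G'.To y z := h2
      have h3 : G'.To z x := h3
      obtain ⟨σ, hσ⟩ := h4.symm.exists_perm_to (n := 3) (by norm_num) (by norm_num) ![x, y, z] (by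
        intro i j; fin_cases i <;> fin_cases j <;>
          simp [h1.ne, h2.ne, h3.ne, h1.ne.symm, h2.ne.symm, h3.ne.symm])
      have hm : ∀ i, ![x, y, z] i ∈ K x := by
        intro i
        fin_cases i
        · exact hrefl x
        · exact hsub hx hy
        · exact hsub hx hz
      exact (hKint x).acyc _ (hm _) _ (hm _) _ (hm _) ((hσ 0 1).1 h1) ((hσ 1 2).1 h2)
        ((hσ 2 0).1 h3)
  · intro x y hxy
    have hne : x ≠ y := by rintro rfl; exact hxy rfl
    have hnr : ∀ {x y}, K x ≠ K y → G.To x y → DiffStep G G' x y := by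
      intro x y hxy hto
      by_contra hr
      exact hxy (hKeq.2 (chainInt_of_not_rev h hp hto hr))
    change G.Arc y x ↔ G'.Arc x y
    rcases G.trichotomy hne with h1 | h1 | h1
    · exact iff_of_false h1.2 (h1.rev h4 (hnr hxy h1)).2
    · exact iff_of_true h1.1 (h1.rev h4 (hnr (Ne.symm hxy) h1)).1
    · rw [← ((neutral_iff _ _ _).1 h1).2]
      exact not_diffStep (h1.not_diffStep h4)
  · intro x x' y y' hx hy hxy
    have h1 : x' ∈ K x := hKeq.1 hx
    have h2 : y' ∈ K y := hKeq.1 hy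
    have h3 : x' ∉ K y := fun h' => hxy (hx.trans (hKeq.2 h').symm)
    have h5 : y ∉ K x := fun h' => hxy (hKeq.2 h')
    change G.Arc y x ↔ G.Arc y' x'
    rw [((hKint x).uni y h5 x (hrefl x) x' h1).1]
    exact ((hKint y).uni x' h3 y (hrefl y) y' h2).2

/-- A small prechain which is a single difference class is self-dual. -/
theorem selfDual_of_card {k : ℕ} (h : Cls G G') (hk : LeHypo k G G') (hp : Pre G) [Finite V]
    (hc : Nat.card V ≤ k) : SelfDual G := by
  by_cases hne : Nonempty V
  · have h1 := dual_iso h hp fun I _ _ => I.toFinite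
    exact (hk.iso_of_card hc).trans h1.symm
  · exact ⟨Equiv.refl V, fun x => absurd ⟨x⟩ hne⟩

end Dual

section NonTournament
variable {G G' : Dgraph V}

theorem five_rule (h : Cls G G') (h5 : LeHypo 5 G G') (hp : Pre G) {a b x₁ x₂ y : V}
    (hab : G.Neutral a b) (a1 : G.To a x₁) (a2 : G.To a x₂) (b1 : G.To x₁ b) (b2 : G.To x₂ b)
    (ya : G.To y a) (yb : G.To b y) (h12 : G.To x₁ x₂) (y1 : G.To y x₁) : ¬ G.To y x₂ := by
  intro y2
  have h4 := h.hypo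
  have ra : ∀ z, z ≠ a → z ≠ b → DiffStep G G' a z ∧ DiffStep G G' z b := fun z hz hz' =>
    ⟨(neutral_between h hp.nn hab hz hz').1, (neutral_between h hp.nn hab hz hz').2.1⟩
  have r1 := ra x₁ a1.ne.symm b1.ne
  have r2 := ra x₂ a2.ne.symm b2.ne
  have r3 := ra y ya.ne yb.ne.symm
  have hne := hab.1
  obtain ⟨σ, hσ⟩ := h5.exists_perm_to (n := 5) (by norm_num) (by norm_num) ![a, b, x₁, x₂, y] (by
    intro i j; fin_cases i <;> fin_cases j <;>
      simp [hne, hne.symm, a1.ne, a2.ne, b1.ne, b2.ne, ya.ne, yb.ne, h12.ne, y1.ne, y2.ne,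
        a1.ne.symm, a2.ne.symm, b1.ne.symm, b2.ne.symm, ya.ne.symm, yb.ne.symm, h12.ne.symm,
        y1.ne.symm, y2.ne.symm])
  have c1 := a1.rev h4 r1.1
  have c2 := a2.rev h4 r2.1
  have c3 := b1.rev h4 r1.2
  have c4 := b2.rev h4 r2.2
  have c5 := ya.rev h4 (r3.1.symm h4)
  have c6 := yb.rev h4 (r3.2.symm h4)
  have c7 := y1.rev h4 (cycle_rev h hp y1 b1 yb)
  have c8 := y2.rev h4 (cycle_rev h hp y2 b2 yb)
  have c0 := hab.keep h4
  have c9 : G'.To x₁ x₂ ∨ G'.To x₂ x₁ := by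
    by_cases hr : DiffStep G G' x₁ x₂
    · exact Or.inr (h12.rev h4 hr)
    · exact Or.inl (h12.keep h4 hr)
  have hd : ∀ i j : Fin 5, i ≠ j → ¬ G'.To (![a, b, x₁, x₂, y] i) (![a, b, x₁, x₂, y] j) →
      ¬ G'.To (![a, b, x₁, x₂, y] j) (![a, b, x₁, x₂, y] i) → (i = 0 ∧ j = 1) ∨ (i = 1 ∧ j = 0) := by
    intro i j
    fin_cases i <;> fin_cases j <;> simp [c1, c2, c3, c4, c5, c6, c7, c8]
    · rcases c9 with c | c <;> simp [c]
    · rcases c9 with c | c <;> simp [c]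
  have hn := hab.not_to
  have e0 : ∀ j, G'.To (![a, b, x₁, x₂, y] 0) (![a, b, x₁, x₂, y] j) → j = 4 := by
    intro j; fin_cases j <;> simp [c0.not_to.1, c1.asymm, c2.asymm]
    exact fun h => h.asymm h
  have e4 : ∀ j, G'.To (![a, b, x₁, x₂, y] 4) (![a, b, x₁, x₂, y] j) → j = 1 := by
    intro j; fin_cases j <;> simp [c5.asymm, c7.asymm, c8.asymm]
    exact fun h => h.asymm h
  have hs : ∀ i j, σ i = σ j → i = j := fun i j h => σ.injective h
  rcases hd (σ 0) (σ 1) (fun h => absurd (hs _ _ h) (by decide)) (fun h => hn.1 ((hσ 0 1).2 h))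
    (fun h => hn.2 ((hσ 1 0).2 h)) with ⟨d1, d2⟩ | ⟨d1, d2⟩
  · have k1 := e0 _ (d1 ▸ (hσ 0 2).1 a1)
    have k2 := e0 _ (d1 ▸ (hσ 0 3).1 a2)
    exact absurd (hs _ _ (k1.trans k2.symm)) (by decide)
  · have k := e0 _ (d2 ▸ (hσ 1 4).1 yb)
    have k1 := e4 _ (k ▸ (hσ 4 2).1 y1)
    have k2 := e4 _ (k ▸ (hσ 4 3).1 y2)
    exact absurd (hs _ _ (k1.trans k2.symm)) (by decide)

/-- The structure of a prechain around a neutral pair `{a, b}`: the other vertices are split into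
those between `a` and `b` and those between `b` and `a`. -/
structure Split (G : Dgraph V) (a b : V) : Prop where
  pre : Pre G
  neutral : G.Neutral a b
  cov : ∀ z, z = a ∨ z = b ∨ (G.To a z ∧ G.To z b) ∨ (G.To b z ∧ G.To z a)
  left : ∀ {x₁ x₂ y}, G.To a x₁ → G.To x₁ b → G.To a x₂ → G.To x₂ b → G.To b y → G.To y a →
    G.To x₁ x₂ → ¬ G.To x₁ y ∧ ¬ G.To y x₂
  right : ∀ {x₁ x₂ y}, G.To b x₁ → G.To x₁ a → G.To b x₂ → G.To x₂ a → G.To a y → G.To y b →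
    G.To x₁ x₂ → ¬ G.To x₁ y ∧ ¬ G.To y x₂

theorem Split.swap {a b : V} (s : Split G a b) : Split G b a where
  pre := s.pre
  neutral := s.neutral.symm
  cov z := by have := s.cov z; tauto
  left := s.right
  right := s.left

theorem split_left (h : Cls G G') (h5 : LeHypo 5 G G') (hp : Pre G) {a b x₁ x₂ y : V}
    (hab : G.Neutral a b) (a1 : G.To a x₁) (b1 : G.To x₁ b) (a2 : G.To a x₂) (b2 : G.To x₂ b)
    (yb : G.To b y) (ya : G.To y a) (h12 : G.To x₁ x₂) : ¬ G.To x₁ y := by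
  intro h1
  have hne : x₂ ≠ y := by rintro rfl; exact yb.asymm b2
  rcases G.trichotomy hne with k | k | k
  · exact five_rule h.dual h5.dual hp.dual (a := b) (b := a) (y := y) (x₁ := x₂) (x₂ := x₁)
      ((neutral_dual _ _ _).2 hab.symm) b2 b1 a2 a1 yb ya h12 k h1
  · exact hp.in_dia a1 h1 ya a2 h12 k
  · exact hp.out_peak k h12 h1

theorem split_of (h : Cls G G') (h5 : LeHypo 5 G G') (hp : Pre G) {a b : V}
    (hab : G.Neutral a b) : Split G a b := by
  have key : ∀ {a b x₁ x₂ y : V}, G.Neutral a b → G.To a x₁ → G.To x₁ b → G.To a x₂ → G.To x₂ b →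
      G.To b y → G.To y a → G.To x₁ x₂ → ¬ G.To x₁ y ∧ ¬ G.To y x₂ :=
    fun hab a1 b1 a2 b2 yb ya h12 => ⟨split_left h h5 hp hab a1 b1 a2 b2 yb ya h12,
      split_left h.dual h5.dual hp.dual ((neutral_dual _ _ _).2 hab.symm) b2 a2 b1 a1 ya yb h12⟩
  refine ⟨hp, hab, fun z => ?_, key hab, key hab.symm⟩
  by_cases h1 : z = a
  · exact Or.inl h1
  by_cases h2 : z = b
  · exact Or.inr (Or.inl h2)
  have := (neutral_between h hp.nn hab h1 h2).2.2
  tauto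

namespace Split
variable {a b : V}

theorem dir (s : Split G a b) {x₁ x₂ : V} (a1 : G.To a x₁) (a2 : G.To a x₂) (hne : x₁ ≠ x₂) :
    G.To x₁ x₂ ∨ G.To x₂ x₁ := by
  rcases G.trichotomy hne with k | k | k
  · exact Or.inl k
  · exact Or.inr k
  · exact absurd a2 (s.pre.out_peak k a1)

theorem trans (s : Split G a b) {x₁ x₂ x₃ : V} (a1 : G.To a x₁) (a2 : G.To a x₂) (a3 : G.To a x₃)
    (h12 : G.To x₁ x₂) (h23 : G.To x₂ x₃) : G.To x₁ x₃ := by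
  have hne : x₁ ≠ x₃ := by rintro rfl; exact h12.asymm h23
  rcases s.dir a1 a3 hne with k | k
  · exact k
  · exact absurd a3 (s.pre.out_dia h12 h23 k a1 a2)

/-- If nothing lies between `b` and `a`, the vertices between `a` and `b` form a chain interval. -/
theorem selfDual_of_isEmpty (s : Split G a b) (hN : NoInfChain G)
    (hB : ∀ z, ¬ (G.To b z ∧ G.To z a)) : SelfDual G := by
  classical
  have cov : ∀ z, z = a ∨ z = b ∨ (G.To a z ∧ G.To z b) := fun z => by
    have := s.cov z; have := hB z; tauto
  have hI : ChainInt G {z | G.To a z ∧ G.To z b} := by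
    refine ⟨?_, ?_, ?_⟩
    · rintro w hw y ⟨y1, y2⟩ z ⟨z1, z2⟩
      rcases cov w with rfl | rfl | h
      · simp [y1.1, y1.2, z1.1, z1.2]
      · simp [y2.1, y2.2, z2.1, z2.2]
      · exact absurd h hw
    · exact fun x hx y hy hne => s.dir hx.1 hy.1 hne
    · exact fun x hx y hy z hz h1 h2 h3 => (s.trans hx.1 hy.1 hz.1 h1 h2).asymm h3
  have hne := s.neutral.1
  have hn := ((neutral_iff _ _ _).1 s.neutral).2
  refine selfDual_of_chainInt hI (hI.finite hN) (Equiv.swap a b) ?_ ?_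
  · rintro x ⟨h1, h2⟩
    exact Equiv.swap_apply_of_ne_of_ne h1.ne.symm h2.ne
  · have hx : ∀ {x}, (G.To a x ∧ G.To x b) → Equiv.swap a b x = x := fun h =>
      Equiv.swap_apply_of_ne_of_ne h.1.ne.symm h.2.ne
    intro x y hxy
    rcases cov x with rfl | rfl | h <;> rcases cov y with rfl | rfl | h'
    · simp [G.irrefl]
    · simp
    · rw [hx h']; simp [h'.1.1, h'.2.1]
    · simp
    · simp [G.irrefl]
    · rw [hx h']; simp [h'.1.2, h'.2.2]
    · rw [hx h]; simp [h.1.2, h.2.2]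
    · rw [hx h]; simp [h.1.1, h.2.1]
    · exact absurd ⟨h, h'⟩ hxy

end Split
end NonTournament

section SmallCases
variable {G G' : Dgraph V}

/-- A digraph is self-dual if it has an anti-automorphism, given on an enumeration. -/
theorem selfDual_of_enum {n : ℕ} (v : Fin n → V) (hinj : Function.Injective v)
    (hsurj : Function.Surjective v) (τ : Equiv.Perm (Fin n))
    (h : ∀ i j, G.Arc (v i) (v j) ↔ G.Arc (v (τ j)) (v (τ i))) : SelfDual G := by
  let e := Equiv.ofBijective v ⟨hinj, hsurj⟩
  refine ⟨(e.symm.trans τ).trans e, fun x y => ?_⟩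
  obtain ⟨i, rfl⟩ := hsurj x
  obtain ⟨j, rfl⟩ := hsurj y
  have h1 : ∀ i, e.symm (v i) = i := fun i => e.symm_apply_apply i
  change _ ↔ G.Arc (v (τ (e.symm (v j)))) (v (τ (e.symm (v i))))
  rw [h1, h1]
  exact h i j

/-- A small prechain which is a single difference class is self-dual. -/
theorem selfDual_of_surj {k n : ℕ} (h : Cls G G') (hk : LeHypo k G G') (hp : Pre G)
    (v : Fin n → V) (hv : Function.Surjective v) (hn : n ≤ k) : SelfDual G := by
  have := Finite.of_surjective v hv
  have := Nat.card_le_card_of_surjective v hv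
  rw [Nat.card_fin] at this
  exact selfDual_of_card h hk hp (this.trans hn)

namespace Split
variable {a b : V}

/-- The case of three vertices between `a` and `b`. -/
theorem selfDual_of_three (s : Split G a b) {x₁ x₂ x₃ y : V} (a1 : G.To a x₁) (b1 : G.To x₁ b)
    (a2 : G.To a x₂) (b2 : G.To x₂ b) (a3 : G.To a x₃) (b3 : G.To x₃ b) (yb : G.To b y)
    (ya : G.To y a) (h12 : G.To x₁ x₂) (h23 : G.To x₂ x₃) : SelfDual G := by
  have mid : ∀ {x₁ x₂ x₃ y}, G.To a x₁ → G.To x₁ b → G.To a x₂ → G.To x₂ b → G.To a x₃ →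
      G.To x₃ b → G.To b y → G.To y a → G.To x₁ x₂ → G.To x₂ x₃ → G.Neutral x₂ y := by
    intro x₁ x₂ x₃ y a1 b1 a2 b2 a3 b3 yb ya h12 h23
    have hne : x₂ ≠ y := by rintro rfl; exact a2.asymm ya
    have := (s.left a1 b1 a2 b2 yb ya h12).2
    have := (s.left a2 b2 a3 b3 yb ya h23).1
    have := G.trichotomy hne
    tauto
  have hm := mid a1 b1 a2 b2 a3 b3 yb ya h12 h23
  have h13 := s.trans a1 a2 a3 h12 h23
  have hA : ∀ w, G.To a w → G.To w b → w = x₁ ∨ w = x₂ ∨ w = x₃ := by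
    intro w aw bw
    by_contra hw
    push Not at hw
    have no : ∀ {u v}, G.To a u → G.To u b → G.To a v → G.To v b → w ≠ x₂ → G.To u w →
        ¬ G.To w v := fun p q r t hw h1 h2 =>
      hw (s.pre.nn (mid p q aw bw r t yb ya h1 h2).symm hm.symm)
    rcases s.dir aw a1 hw.1 with k1 | k1
    · exact h12.ne (s.pre.nn (mid aw bw a1 b1 a2 b2 yb ya k1 h12).symm hm.symm)
    · rcases s.dir aw a3 hw.2.2 with k3 | k3
      · exact no a1 b1 a3 b3 hw.2.1 k1 k3
      · exact h23.ne.symm (s.pre.nn (mid a2 b2 a3 b3 aw bw yb ya h23 k3).symm hm.symm)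
  have hB : ∀ w, G.To b w → G.To w a → w = y := fun w bw wa =>
    s.pre.nn (mid a1 b1 a2 b2 a3 b3 bw wa h12 h23) hm
  have y1 : G.To y x₁ := by
    have hne : x₁ ≠ y := by rintro rfl; exact a1.asymm ya
    have := (s.left a1 b1 a2 b2 yb ya h12).1
    have h' : ¬ G.Neutral x₁ y := fun h' => h12.ne (s.pre.nn h'.symm hm.symm)
    have := G.trichotomy hne
    tauto
  have y3 : G.To x₃ y := by
    have hne : x₃ ≠ y := by rintro rfl; exact a3.asymm ya
    have := (s.left a2 b2 a3 b3 yb ya h23).2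
    have h' : ¬ G.Neutral x₃ y := fun h' => h23.ne.symm (s.pre.nn h'.symm hm.symm)
    have := G.trichotomy hne
    tauto
  have hne := s.neutral.1
  have e1 := ((neutral_iff _ _ _).1 s.neutral).2
  have e2 := ((neutral_iff _ _ _).1 hm).2
  refine selfDual_of_enum ![a, b, x₁, x₂, x₃, y] ?_ ?_ (Equiv.swap 0 1 * Equiv.swap 2 4) ?_
  · intro i j
    fin_cases i <;> fin_cases j <;>
      simp [hne, hne.symm, a1.ne, a2.ne, a3.ne, b1.ne, b2.ne, b3.ne, ya.ne, yb.ne, h12.ne, y1.ne,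
        y3.ne, h13.ne, h23.ne, hm.1,
        a1.ne.symm, a2.ne.symm, b1.ne.symm, b2.ne.symm, ya.ne.symm, yb.ne.symm, h12.ne.symm,
        y1.ne.symm, y3.ne.symm, h13.ne.symm, h23.ne.symm, a3.ne.symm, b3.ne.symm, hm.1.symm]
  · intro z
    rcases s.cov z with rfl | rfl | ⟨h1, h2⟩ | ⟨h1, h2⟩
    · exact ⟨0, rfl⟩
    · exact ⟨1, rfl⟩
    · rcases hA z h1 h2 with rfl | rfl | rfl
      · exact ⟨2, rfl⟩
      · exact ⟨3, rfl⟩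
      · exact ⟨4, rfl⟩
    · obtain rfl := hB z h1 h2
      exact ⟨5, rfl⟩
  · have t0 : (Equiv.swap 0 1 * Equiv.swap 2 4 : Equiv.Perm (Fin 6)) 0 = 1 := by decide
    have t1 : (Equiv.swap 0 1 * Equiv.swap 2 4 : Equiv.Perm (Fin 6)) 1 = 0 := by decide
    have t2 : (Equiv.swap 0 1 * Equiv.swap 2 4 : Equiv.Perm (Fin 6)) 2 = 4 := by decide
    have t3 : (Equiv.swap 0 1 * Equiv.swap 2 4 : Equiv.Perm (Fin 6)) 3 = 3 := by decide
    have t4 : (Equiv.swap 0 1 * Equiv.swap 2 4 : Equiv.Perm (Fin 6)) 4 = 2 := by decide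
    have t5 : (Equiv.swap 0 1 * Equiv.swap 2 4 : Equiv.Perm (Fin 6)) 5 = 5 := by decide
    generalize (Equiv.swap 0 1 * Equiv.swap 2 4 : Equiv.Perm (Fin 6)) = τ at *
    intro i j
    fin_cases i <;> fin_cases j <;>
      simp [t0, t1, t2, t3, t4, t5, G.irrefl, a1.1, a2.1, a3.1, b1.1, b2.1, b3.1, ya.1, yb.1,
        h12.1, h13.1, h23.1, y1.1, y3.1, a1.2, a2.2, a3.2, b1.2, b2.2, b3.2, ya.2, yb.2,
        h12.2, h13.2, h23.2, y1.2, y3.2, e1, e2]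

end Split

/-- A hexagon in which two antipodal neutral pairs have the same type is self-dual. -/
theorem selfDual_of_hexagon (u : Fin 6 → V) (hs : Function.Surjective u)
    (h1 : ∀ i, G.To (u i) (u (i + 1))) (h2 : ∀ i, G.To (u i) (u (i + 2)))
    (h3 : ∀ i, G.Neutral (u i) (u (i + 3))) (h : G.Arc (u 1) (u 4) ↔ G.Arc (u 2) (u 5)) :
    SelfDual G := by
  have e : ∀ i, (G.Arc (u (i + 3)) (u i) ↔ G.Arc (u i) (u (i + 3))) := fun i =>
    ((neutral_iff _ _ _).1 (h3 i)).2.symm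
  have a1 := fun i => (h1 i).1
  have a2 := fun i => (h2 i).1
  have b1 := fun i => (h1 i).2
  have b2 := fun i => (h2 i).2
  refine selfDual_of_enum u ?_ hs (Equiv.neg (Fin 6)) ?_
  · intro i j hij
    have p1 := fun i => (h1 i).ne
    have p2 := fun i => (h2 i).ne
    have p3 := fun i => (h3 i).1
    have k : i = j ∨ j = i + 1 ∨ j = i + 2 ∨ j = i + 3 ∨ i = j + 1 ∨ i = j + 2 := by
      clear hij; revert i j; decide
    rcases k with rfl | rfl | rfl | rfl | rfl | rfl
    · rfl
    · exact absurd hij (p1 i)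
    · exact absurd hij (p2 i)
    · exact absurd hij (p3 i)
    · exact absurd hij.symm (p1 j)
    · exact absurd hij.symm (p2 j)
  · intro i j
    have k : i = j ∨ j = i + 1 ∨ j = i + 2 ∨ j = i + 3 ∨ i = j + 1 ∨ i = j + 2 := by
      revert i j; decide
    simp only [Equiv.neg_apply]
    rcases k with rfl | rfl | rfl | rfl | rfl | rfl
    · simp [G.irrefl]
    · have := a1 (-(i + 1)); rw [(by decide : ∀ i : Fin 6, -(i + 1) + 1 = -i) i] at this
      exact iff_of_true (a1 i) this
    · have := a2 (-(i + 2)); rw [(by decide : ∀ i : Fin 6, -(i + 2) + 2 = -i) i] at this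
      exact iff_of_true (a2 i) this
    · have e0 : G.Arc (u 3) (u 0) ↔ G.Arc (u 0) (u 3) := e 0
      have e1 : G.Arc (u 4) (u 1) ↔ G.Arc (u 1) (u 4) := e 1
      have e2 : G.Arc (u 5) (u 2) ↔ G.Arc (u 2) (u 5) := e 2
      fin_cases i
      · exact e0.symm
      · exact h
      · exact h.symm
      · exact e0
      · exact e1.trans (h.trans e2.symm)
      · exact e2.trans (h.symm.trans e1.symm)
    · have := b1 (-(j + 1)); rw [(by decide : ∀ j : Fin 6, -(j + 1) + 1 = -j) j] at this
      exact iff_of_false (b1 j) this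
    · have := b2 (-(j + 2)); rw [(by decide : ∀ j : Fin 6, -(j + 2) + 2 = -j) j] at this
      exact iff_of_false (b2 j) this

theorem selfDual_of_hexagon' (u : Fin 6 → V) (hs : Function.Surjective u)
    (h1 : ∀ i, G.To (u i) (u (i + 1))) (h2 : ∀ i, G.To (u i) (u (i + 2)))
    (h3 : ∀ i, G.Neutral (u i) (u (i + 3))) : SelfDual G := by
  have e : ∀ i, (G.Arc (u (i + 3)) (u i) ↔ G.Arc (u i) (u (i + 3))) := fun i =>
    ((neutral_iff _ _ _).1 (h3 i)).2.symm
  have rot : ∀ c : Fin 6, (G.Arc (u (1 + c)) (u (4 + c)) ↔ G.Arc (u (2 + c)) (u (5 + c))) →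
      SelfDual G := by
    intro c hc
    refine selfDual_of_hexagon (fun i => u (i + c)) (hs.comp (Equiv.addRight c).surjective)
      (fun i => ?_) (fun i => ?_) (fun i => ?_) hc
    · have := h1 (i + c); rwa [(by decide : ∀ i c : Fin 6, i + c + 1 = i + 1 + c) i c] at this
    · have := h2 (i + c); rwa [(by decide : ∀ i c : Fin 6, i + c + 2 = i + 2 + c) i c] at this
    · have := h3 (i + c); rwa [(by decide : ∀ i c : Fin 6, i + c + 3 = i + 3 + c) i c] at this
  have r0 := rot 0
  have r1 := rot 1
  have r2 := rot 2
  have e0 := e 0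
  have e1 := e 1
  have e2 := e 2
  simp at r0 r1 r2 e0 e1 e2
  rw [e0] at r1 r2
  rw [e1] at r2
  tauto

namespace Split
variable {a b : V}

theorem pair_or (s : Split G a b) {x : V} (ax : G.To a x) (bx : G.To x b) :
    (∃ x₁ x₂ x₃, G.To a x₁ ∧ G.To x₁ b ∧ G.To a x₂ ∧ G.To x₂ b ∧ G.To a x₃ ∧ G.To x₃ b ∧
      G.To x₁ x₂ ∧ G.To x₂ x₃) ∨
    (∃ x₁ x₂, G.To a x₁ ∧ G.To x₁ b ∧ G.To a x₂ ∧ G.To x₂ b ∧ G.To x₁ x₂ ∧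
      ∀ w, G.To a w → G.To w b → w = x₁ ∨ w = x₂) ∨
    (∀ w, G.To a w → G.To w b → w = x) := by
  by_cases h1 : ∀ w, G.To a w → G.To w b → w = x
  · exact Or.inr (Or.inr h1)
  push Not at h1
  obtain ⟨w, aw, bw, hw⟩ := h1
  obtain ⟨x₁, x₂, a1, b1, a2, b2, h12⟩ : ∃ x₁ x₂, G.To a x₁ ∧ G.To x₁ b ∧ G.To a x₂ ∧ G.To x₂ b ∧
      G.To x₁ x₂ := by
    rcases s.dir aw ax hw with k | k
    · exact ⟨w, x, aw, bw, ax, bx, k⟩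
    · exact ⟨x, w, ax, bx, aw, bw, k⟩
  by_cases h2 : ∀ w, G.To a w → G.To w b → w = x₁ ∨ w = x₂
  · exact Or.inr (Or.inl ⟨x₁, x₂, a1, b1, a2, b2, h12, h2⟩)
  push Not at h2
  obtain ⟨z, az, bz, hz1, hz2⟩ := h2
  left
  rcases s.dir az a1 hz1 with k | k
  · exact ⟨z, x₁, x₂, az, bz, a1, b1, a2, b2, k, h12⟩
  · rcases s.dir az a2 hz2 with k' | k'
    · exact ⟨x₁, z, x₂, a1, b1, az, bz, a2, b2, k, k'⟩
    · exact ⟨x₁, x₂, z, a1, b1, a2, b2, az, bz, h12, k'⟩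

theorem selfDual_of_two (s : Split G a b) {x₁ x₂ y₁ y₂ : V} (a1 : G.To a x₁) (b1 : G.To x₁ b)
    (a2 : G.To a x₂) (b2 : G.To x₂ b) (h12 : G.To x₁ x₂)
    (hA : ∀ w, G.To a w → G.To w b → w = x₁ ∨ w = x₂)
    (c1 : G.To b y₁) (d1 : G.To y₁ a) (c2 : G.To b y₂) (d2 : G.To y₂ a) (k12 : G.To y₁ y₂)
    (hB : ∀ w, G.To b w → G.To w a → w = y₁ ∨ w = y₂) : SelfDual G := by
  have ne : ∀ {x y}, G.To a x → G.To y a → x ≠ y := by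
    rintro x y h1 h2 rfl; exact h1.asymm h2
  have n1 : G.Neutral x₁ y₁ := by
    have := (s.left a1 b1 a2 b2 c1 d1 h12).1
    have := (s.right c1 d1 c2 d2 a1 b1 k12).1
    have := G.trichotomy (ne a1 d1)
    tauto
  have n2 : G.Neutral x₂ y₂ := by
    have := (s.left a1 b1 a2 b2 c2 d2 h12).2
    have := (s.right c1 d1 c2 d2 a2 b2 k12).2
    have := G.trichotomy (ne a2 d2)
    tauto
  have m1 : G.To y₂ x₁ := by
    have := (s.left a1 b1 a2 b2 c2 d2 h12).1
    have h' : ¬ G.Neutral x₁ y₂ := fun h' => k12.ne (s.pre.nn n1 h')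
    have := G.trichotomy (ne a1 d2)
    tauto
  have m2 : G.To x₂ y₁ := by
    have := (s.left a1 b1 a2 b2 c1 d1 h12).2
    have h' : ¬ G.Neutral x₂ y₁ := fun h' => k12.ne (s.pre.nn h' n2)
    have := G.trichotomy (ne a2 d1)
    tauto
  have n0 := s.neutral
  have n0' := n0.symm
  have n1' := n1.symm
  have n2' := n2.symm
  refine selfDual_of_hexagon' ![a, x₁, x₂, b, y₁, y₂] ?_ ?_ ?_ ?_
  · intro z
    rcases s.cov z with rfl | rfl | ⟨h1, h2⟩ | ⟨h1, h2⟩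
    · exact ⟨0, rfl⟩
    · exact ⟨3, rfl⟩
    · rcases hA z h1 h2 with rfl | rfl
      · exact ⟨1, rfl⟩
      · exact ⟨2, rfl⟩
    · rcases hB z h1 h2 with rfl | rfl
      · exact ⟨4, rfl⟩
      · exact ⟨5, rfl⟩
  all_goals intro i; fin_cases i <;> assumption

end Split

/-- A non-tournament prechain which is a single difference class of `(≤ 5)`-hypomorphic digraphs is
self-dual. -/
theorem selfDual_of_neutral (h : Cls G G') (h5 : LeHypo 5 G G') (hp : Pre G) (hN : NoInfChain G)
    {a b : V} (hab : G.Neutral a b) : SelfDual G := by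
  have s := split_of h h5 hp hab
  by_cases hB : ∃ y, G.To b y ∧ G.To y a
  swap
  · exact s.selfDual_of_isEmpty hN (by push Not at hB; rintro z ⟨h1, h2⟩; exact hB z h1 h2)
  by_cases hA : ∃ x, G.To a x ∧ G.To x b
  swap
  · exact s.swap.selfDual_of_isEmpty hN (by push Not at hA; rintro z ⟨h1, h2⟩; exact hA z h1 h2)
  obtain ⟨y, yb, ya⟩ := hB
  obtain ⟨x, ax, bx⟩ := hA
  rcases s.pair_or ax bx with ⟨x₁, x₂, x₃, a1, b1, a2, b2, a3, b3, h12, h23⟩ |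
    ⟨x₁, x₂, a1, b1, a2, b2, h12, hA⟩ | hA
  · exact s.selfDual_of_three a1 b1 a2 b2 a3 b3 yb ya h12 h23
  all_goals rcases s.swap.pair_or yb ya with ⟨y₁, y₂, y₃, c1, d1, c2, d2, c3, d3, k12, k23⟩ |
    ⟨y₁, y₂, c1, d1, c2, d2, k12, hB⟩ | hB
  · exact s.swap.selfDual_of_three c1 d1 c2 d2 c3 d3 ax bx k12 k23
  · exact s.selfDual_of_two a1 b1 a2 b2 h12 hA c1 d1 c2 d2 k12 hB
  · refine selfDual_of_surj h h5 hp ![a, b, x₁, x₂, y] (fun z => ?_) le_rfl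
    rcases s.cov z with rfl | rfl | ⟨h1, h2⟩ | ⟨h1, h2⟩
    · exact ⟨0, rfl⟩
    · exact ⟨1, rfl⟩
    · rcases hA z h1 h2 with rfl | rfl
      · exact ⟨2, rfl⟩
      · exact ⟨3, rfl⟩
    · obtain rfl := hB z h1 h2
      exact ⟨4, rfl⟩
  · exact s.swap.selfDual_of_three c1 d1 c2 d2 c3 d3 ax bx k12 k23
  · refine selfDual_of_surj h h5 hp ![a, b, x, y₁, y₂] (fun z => ?_) le_rfl
    rcases s.cov z with rfl | rfl | ⟨h1, h2⟩ | ⟨h1, h2⟩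
    · exact ⟨0, rfl⟩
    · exact ⟨1, rfl⟩
    · obtain rfl := hA z h1 h2
      exact ⟨2, rfl⟩
    · rcases hB z h1 h2 with rfl | rfl
      · exact ⟨3, rfl⟩
      · exact ⟨4, rfl⟩
  · refine selfDual_of_surj h h5 hp ![a, b, x, y] (fun z => ?_) (by norm_num)
    rcases s.cov z with rfl | rfl | ⟨h1, h2⟩ | ⟨h1, h2⟩
    · exact ⟨0, rfl⟩
    · exact ⟨1, rfl⟩
    · obtain rfl := hA z h1 h2
      exact ⟨2, rfl⟩
    · obtain rfl := hB z h1 h2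
      exact ⟨3, rfl⟩

end SmallCases

section Tournament
variable {G G' : Dgraph V}

theorem unbalanced (h : Cls G G') (h6 : LeHypo 6 G G') (hp : Pre G) {p q₁ q₂ r₁ r₂ r₃ : V}
    (hq : q₁ ≠ q₂) (h12 : r₁ ≠ r₂) (h13 : r₁ ≠ r₃) (h23 : r₂ ≠ r₃) (a1 : G.To p q₁)
    (a2 : G.To p q₂) (b1 : G.To r₁ p) (b2 : G.To r₂ p) (b3 : G.To r₃ p) (c11 : G.To q₁ r₁)
    (c12 : G.To q₁ r₂) (c13 : G.To q₁ r₃) (c21 : G.To q₂ r₁) (c22 : G.To q₂ r₂)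
    (c23 : G.To q₂ r₃) : False := by
  have h4 := h.hypo
  obtain ⟨σ, hσ⟩ := h6.exists_perm_to (n := 6) (by norm_num) (by norm_num)
    ![p, q₁, q₂, r₁, r₂, r₃] (by
    intro i j; fin_cases i <;> fin_cases j <;>
      simp [hq, h12, h13, h23, hq.symm, h12.symm, h13.symm, h23.symm, a1.ne, a2.ne, b1.ne, b2.ne,
        b3.ne, c11.ne, c12.ne, c13.ne, c21.ne, c22.ne, c23.ne, a1.ne.symm, a2.ne.symm, b1.ne.symm,
        b2.ne.symm, b3.ne.symm, c11.ne.symm, c12.ne.symm, c13.ne.symm, c21.ne.symm, c22.ne.symm,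
        c23.ne.symm])
  have rv : ∀ {x y z}, G.To x y → G.To y z → G.To z x → G'.To y x := fun h1 h2 h3 =>
    h1.rev h4 (cycle_rev h hp h1 h2 h3)
  have d1 := rv a1 c11 b1
  have d2 := rv a2 c21 b1
  have e1 := rv b1 a1 c11
  have e2 := rv b2 a1 c12
  have e3 := rv b3 a1 c13
  have f1 := rv c11 b1 a1
  have f2 := rv c22 b2 a2
  generalize hv : ![p, q₁, q₂, r₁, r₂, r₃] = v at *
  have v0 : v 0 = p := by rw [← hv]; rfl
  have v1 : v 1 = q₁ := by rw [← hv]; rfl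
  have v2 : v 2 = q₂ := by rw [← hv]; rfl
  have v3 : v 3 = r₁ := by rw [← hv]; rfl
  have v4 : v 4 = r₂ := by rw [← hv]; rfl
  have v5 : v 5 = r₃ := by rw [← hv]; rfl
  have up : ∀ i j : Fin 6, i ≠ 0 → j ≠ 0 → 3 ≤ i → G.To (v i) (v j) → 3 ≤ j := by
    intro i j
    fin_cases i <;> fin_cases j <;>
      simp [v0, v1, v2, v3, v4, v5, c11.asymm, c12.asymm, c13.asymm, c21.asymm, c22.asymm,
        c23.asymm]
  have top : ∀ i : Fin 6, 3 ≤ i → G.To (v i) (v 0) := by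
    intro i
    fin_cases i <;> simp [v0, v3, v4, v5, b1, b2, b3]
  have cyc : ∀ i j k, G.To (v i) (v j) → G.To (v j) (v k) → G.To (v k) (v i) →
      i = 0 ∨ j = 0 ∨ k = 0 := by
    intro i j k hij hjk hki
    by_contra hc
    push Not at hc
    have u1 := fun h => up i j hc.1 hc.2.1 h hij
    have u2 := fun h => up j k hc.2.1 hc.2.2 h hjk
    have u3 := fun h => up k i hc.2.2 hc.1 h hki
    by_cases hi : 3 ≤ i
    · exact hp.in_dia hij hjk hki (top i hi) (top j (u1 hi)) (top k (u2 (u1 hi)))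
    · have n1 : i ≠ j := fun h => hij.ne (congrArg v h)
      have n2 : j ≠ k := fun h => hjk.ne (congrArg v h)
      have n3 : k ≠ i := fun h => hki.ne (congrArg v h)
      have small : ∀ i : Fin 6, i ≠ 0 → ¬ 3 ≤ i → i = 1 ∨ i = 2 := by decide
      have s1 := small i hc.1 hi
      have s2 := small j hc.2.1 fun h => hi (u3 (u2 h))
      have s3 := small k hc.2.2 fun h => hi (u3 h)
      rcases s1 with rfl | rfl <;> rcases s2 with rfl | rfl <;> rcases s3 with rfl | rfl <;>
        simp at n1 n2 n3
  have pull : ∀ i j k, G'.To (v i) (v j) → G'.To (v j) (v k) → G'.To (v k) (v i) →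
      σ 0 = i ∨ σ 0 = j ∨ σ 0 = k := by
    intro i j k
    obtain ⟨i, rfl⟩ := σ.surjective i
    obtain ⟨j, rfl⟩ := σ.surjective j
    obtain ⟨k, rfl⟩ := σ.surjective k
    rw [← hσ, ← hσ, ← hσ]
    intro h1 h2 h3
    rcases cyc i j k h1 h2 h3 with rfl | rfl | rfl <;> simp
  have k1 := pull 0 3 1 (by rwa [v0, v3]) (by rwa [v3, v1]) (by rwa [v1, v0])
  have k2 := pull 0 4 2 (by rwa [v0, v4]) (by rwa [v4, v2]) (by rwa [v2, v0])
  have k0 : σ 0 = 0 := by omega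
  have out : ∀ j, G'.To (v j) (v 0) → j = 1 ∨ j = 2 := by
    intro j
    rw [v0]
    fin_cases j <;> simp [v0, v3, v4, v5, e1.asymm, e2.asymm, e3.asymm]
    exact fun h => h.asymm h
  have o3 := out _ (k0 ▸ (hσ 3 0).1 (by rwa [v0, v3]))
  have o4 := out _ (k0 ▸ (hσ 4 0).1 (by rwa [v0, v4]))
  have o5 := out _ (k0 ▸ (hσ 5 0).1 (by rwa [v0, v5]))
  have n1 : σ 3 ≠ σ 4 := by simp
  have n2 : σ 3 ≠ σ 5 := by simp
  have n3 : σ 4 ≠ σ 5 := by simp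
  omega

/-- Diamond-free tournaments without unbalanced blow-up of a 3-cycle on 6 vertices. -/
structure Bal (G : Dgraph V) : Prop where
  tot : ∀ {x y}, x ≠ y → G.To x y ∨ G.To y x
  out_dia : ∀ {a b c d}, G.To b c → G.To c d → G.To d b → G.To a b → G.To a c → ¬ G.To a d
  in_dia : ∀ {a b c d}, G.To b c → G.To c d → G.To d b → G.To b a → G.To c a → ¬ G.To d a
  fst : ∀ {p q₁ q₂ r₁ r₂ r₃}, q₁ ≠ q₂ → r₁ ≠ r₂ → r₁ ≠ r₃ → r₂ ≠ r₃ → G.To p q₁ → G.To p q₂ →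
    G.To r₁ p → G.To r₂ p → G.To r₃ p → G.To q₁ r₁ → G.To q₁ r₂ → G.To q₁ r₃ → G.To q₂ r₁ →
    G.To q₂ r₂ → G.To q₂ r₃ → False
  snd : ∀ {p q₁ q₂ q₃ r₁ r₂}, q₁ ≠ q₂ → q₁ ≠ q₃ → q₂ ≠ q₃ → r₁ ≠ r₂ → G.To p q₁ → G.To p q₂ →
    G.To p q₃ → G.To r₁ p → G.To r₂ p → G.To q₁ r₁ → G.To q₁ r₂ → G.To q₂ r₁ → G.To q₂ r₂ →
    G.To q₃ r₁ → G.To q₃ r₂ → False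

theorem bal_of (h : Cls G G') (h6 : LeHypo 6 G G') (hp : Pre G)
    (tot : ∀ {x y}, x ≠ y → G.To x y ∨ G.To y x) : Bal G where
  tot := tot
  out_dia := hp.out_dia
  in_dia := hp.in_dia
  fst := unbalanced h h6 hp
  snd := fun n1 n2 n3 n4 a1 a2 a3 b1 b2 c11 c12 c21 c22 c31 c32 =>
    unbalanced h.dual h6.dual hp.dual n4 n1 n2 n3 b1 b2 a1 a2 a3 c11 c21 c31 c12 c22 c32

namespace Bal

/-- Blow-ups of a 3-cycle with two singleton parts. -/
theorem selfDual_of_single (t : Bal G) (hN : NoInfChain G) {p q r : V} (hpq : G.To p q)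
    (hqr : G.To q r) (hrp : G.To r p)
    (cov : ∀ z, z = p ∨ z = q ∨ (G.To q z ∧ G.To z p)) : SelfDual G := by
  classical
  have hI : ChainInt G {z | G.To q z ∧ G.To z p} := by
    refine ⟨?_, ?_, ?_⟩
    · rintro w hw y ⟨y1, y2⟩ z ⟨z1, z2⟩
      rcases cov w with rfl | rfl | h
      · simp [y2.1, y2.2, z2.1, z2.2]
      · simp [y1.1, y1.2, z1.1, z1.2]
      · exact absurd h hw
    · exact fun x hx y hy hne => t.tot hne
    · exact fun x hx y hy z hz h1 h2 h3 => t.out_dia h1 h2 h3 hx.1 hy.1 hz.1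
  refine selfDual_of_chainInt hI (hI.finite hN) (Equiv.swap p q) ?_ ?_
  · rintro x ⟨h1, h2⟩
    exact Equiv.swap_apply_of_ne_of_ne h2.ne h1.ne.symm
  · have hx : ∀ {x}, (G.To q x ∧ G.To x p) → Equiv.swap p q x = x := fun h =>
      Equiv.swap_apply_of_ne_of_ne h.2.ne h.1.ne.symm
    intro x y hxy
    rcases cov x with rfl | rfl | h <;> rcases cov y with rfl | rfl | h'
    · simp [G.irrefl]
    · simp
    · rw [hx h']; simp [h'.1.2, h'.2.2]
    · simp
    · simp [G.irrefl]
    · rw [hx h']; simp [h'.1.1, h'.2.1]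
    · rw [hx h]; simp [h.1.1, h.2.1]
    · rw [hx h]; simp [h.1.2, h.2.2]
    · exact absurd ⟨h, h'⟩ hxy

/-- Blow-ups of a 3-cycle with a part with at least 3 elements. -/
theorem selfDual_of_large (t : Bal G) (hN : NoInfChain G) {P Q R : V → Prop} {q r : V}
    (hq : Q q) (hr : R r) (cov : ∀ z, P z ∨ Q z ∨ R z) (hPQ : ∀ x y, P x → Q y → G.To x y)
    (hQR : ∀ x y, Q x → R y → G.To x y) (hRP : ∀ x y, R x → P y → G.To x y) {x y z : V} (hx : P x)
    (hy : P y) (hz : P z) (hxy : x ≠ y) (hxz : x ≠ z) (hyz : y ≠ z) : SelfDual G := by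
  have hQ1 : ∀ q', Q q' → q' = q := by
    intro q' hq'
    by_contra hne
    exact t.snd hxy hxz hyz hne (hRP r x hr hx) (hRP r y hr hy) (hRP r z hr hz) (hQR _ _ hq' hr)
      (hQR _ _ hq hr) (hPQ _ _ hx hq') (hPQ _ _ hx hq) (hPQ _ _ hy hq') (hPQ _ _ hy hq)
      (hPQ _ _ hz hq') (hPQ _ _ hz hq)
  have hR1 : ∀ r', R r' → r' = r := by
    intro r' hr'
    by_contra hne
    exact t.fst hne hxy hxz hyz (hQR _ _ hq hr') (hQR _ _ hq hr) (hPQ _ _ hx hq) (hPQ _ _ hy hq)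
      (hPQ _ _ hz hq) (hRP _ _ hr' hx) (hRP _ _ hr' hy) (hRP _ _ hr' hz) (hRP _ _ hr hx)
      (hRP _ _ hr hy) (hRP _ _ hr hz)
  refine t.selfDual_of_single hN (hQR _ _ hq hr) (hRP _ _ hr hx) (hPQ _ _ hx hq) fun z => ?_
  rcases cov z with h | h | h
  · exact Or.inr (Or.inr ⟨hRP _ _ hr h, hPQ _ _ h hq⟩)
  · exact Or.inl (hQ1 z h)
  · exact Or.inr (Or.inl (hR1 z h))

theorem two_or_three {P : V → Prop} {p : V} (hp : P p) : (∃ p', ∀ x, P x → x = p ∨ x = p') ∨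
    ∃ x y z, P x ∧ P y ∧ P z ∧ x ≠ y ∧ x ≠ z ∧ y ≠ z := by
  by_cases h : ∀ x, P x → x = p
  · exact Or.inl ⟨p, fun x hx => Or.inl (h x hx)⟩
  push Not at h
  obtain ⟨x, hx, hne⟩ := h
  by_cases h' : ∀ y, P y → y = p ∨ y = x
  · exact Or.inl ⟨x, h'⟩
  push Not at h'
  obtain ⟨y, hy, h1, h2⟩ := h'
  exact Or.inr ⟨p, x, y, hp, hx, hy, hne.symm, h1.symm, h2.symm⟩

theorem selfDual_of_blowup (t : Bal G) (hN : NoInfChain G) (h : Cls G G') (h6 : LeHypo 6 G G')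
    (hpre : Pre G) {P Q R : V → Prop} {p q r : V}
    (hp : P p) (hq : Q q) (hr : R r) (cov : ∀ z, P z ∨ Q z ∨ R z)
    (hPQ : ∀ x y, P x → Q y → G.To x y) (hQR : ∀ x y, Q x → R y → G.To x y)
    (hRP : ∀ x y, R x → P y → G.To x y) : SelfDual G := by
  rcases two_or_three hp with ⟨p', h1⟩ | ⟨x, y, z, hx, hy, hz, n1, n2, n3⟩
  swap
  · exact t.selfDual_of_large hN hq hr cov hPQ hQR hRP hx hy hz n1 n2 n3
  rcases two_or_three hq with ⟨q', h2⟩ | ⟨x, y, z, hx, hy, hz, n1, n2, n3⟩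
  swap
  · exact t.selfDual_of_large hN hr hp (fun z => by have := cov z; tauto) hQR hRP hPQ hx hy hz n1
      n2 n3
  rcases two_or_three hr with ⟨r', h3⟩ | ⟨x, y, z, hx, hy, hz, n1, n2, n3⟩
  swap
  · exact t.selfDual_of_large hN hp hq (fun z => by have := cov z; tauto) hRP hPQ hQR hx hy hz n1
      n2 n3
  refine selfDual_of_surj h h6 hpre ![p, p', q, q', r, r'] (fun z => ?_) le_rfl
  rcases cov z with hz | hz | hz
  · rcases h1 z hz with rfl | rfl
    · exact ⟨0, rfl⟩
    · exact ⟨1, rfl⟩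
  · rcases h2 z hz with rfl | rfl
    · exact ⟨2, rfl⟩
    · exact ⟨3, rfl⟩
  · rcases h3 z hz with rfl | rfl
    · exact ⟨4, rfl⟩
    · exact ⟨5, rfl⟩

/-- A backward arc between consecutive parts around a 3-cycle determines two more arcs. -/
theorem backward (t : Bal G) {p q r x y : V} (hpq : G.To p q)
    (hqr : G.To q r) (hrp : G.To r p) (xq : G.To x q) (rx : G.To r x) (yr : G.To y r)
    (py : G.To p y) (yx : G.To y x) : G.To x p ∧ G.To q y := by
  constructor
  · have hne : x ≠ p := by rintro rfl; exact py.asymm yx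
    exact (t.tot hne).resolve_right fun px => t.in_dia py yr hrp px yx rx
  · have hne : q ≠ y := by rintro rfl; exact xq.asymm yx
    exact (t.tot hne).resolve_right fun yq => t.out_dia xq hqr rx yx yq yr

/-- The circular tournament on 5 vertices. -/
structure Circ (G : Dgraph V) (v : Fin 5 → V) : Prop where
  one : ∀ i, G.To (v i) (v (i + 1))
  two : ∀ i, G.To (v i) (v (i + 2))

theorem forward_or_circ (t : Bal G) {p q r : V} (hpq : G.To p q) (hqr : G.To q r)
    (hrp : G.To r p) : (∀ x y, (G.To x q ∧ G.To r x) → (G.To y r ∧ G.To p y) → G.To x y) ∨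
      ∃ v, Circ G v := by
  by_contra hc
  push Not at hc
  obtain ⟨⟨x, y, ⟨xq, rx⟩, ⟨yr, py⟩, hxy⟩, hc⟩ := hc
  have hne : x ≠ y := by rintro rfl; exact rx.asymm yr
  have yx := (t.tot hne).resolve_left hxy
  obtain ⟨xp, qy⟩ := t.backward hpq hqr hrp xq rx yr py yx
  refine hc ![x, p, q, y, r] ⟨?_, ?_⟩ <;> intro i <;> fin_cases i <;> assumption

theorem circ_or_selfDual (t : Bal G) (hN : NoInfChain G) (h : Cls G G') (h6 : LeHypo 6 G G')
    (hpre : Pre G) {p q r : V} (hpq : G.To p q) (hqr : G.To q r) (hrp : G.To r p) :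
    SelfDual G ∨ ∃ v, Circ G v := by
  rcases t.forward_or_circ hpq hqr hrp with h1 | h1
  swap
  · exact Or.inr h1
  rcases t.forward_or_circ hqr hrp hpq with h2 | h2
  swap
  · exact Or.inr h2
  rcases t.forward_or_circ hrp hpq hqr with h3 | h3
  swap
  · exact Or.inr h3
  refine Or.inl (t.selfDual_of_blowup hN h h6 hpre (P := fun x => G.To x q ∧ G.To r x)
    (Q := fun x => G.To x r ∧ G.To p x) (R := fun x => G.To x p ∧ G.To q x) ⟨hpq, hrp⟩ ⟨hqr, hpq⟩
    ⟨hrp, hqr⟩ (fun z => ?_) h1 h2 h3)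
  by_cases zp : z = p
  · exact Or.inl (zp ▸ ⟨hpq, hrp⟩)
  by_cases zq : z = q
  · exact Or.inr (Or.inl (zq ▸ ⟨hqr, hpq⟩))
  by_cases zr : z = r
  · exact Or.inr (Or.inr (zr ▸ ⟨hrp, hqr⟩))
  have := t.tot zp
  have := t.tot zq
  have := t.tot zr
  have := t.out_dia hpq hqr hrp (a := z)
  have := t.in_dia hpq hqr hrp (a := z)
  tauto

end Bal
end Tournament

section Circular
variable {G G' : Dgraph V}

/-- `x` behaves like the `i`-th vertex of a circular tournament on 5 vertices. -/
structure Twin (G : Dgraph V) (v : Fin 5 → V) (i : Fin 5) (x : V) : Prop where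
  one : G.To x (v (i + 1))
  two : G.To x (v (i + 2))
  three : G.To (v (i + 3)) x
  four : G.To (v (i + 4)) x

namespace Bal

theorem Circ.rotate {v : Fin 5 → V} (hv : Circ G v) (c : Fin 5) : Circ G fun i => v (i + c) where
  one i := by have := hv.one (i + c); rwa [(by decide : ∀ i c : Fin 5, i + c + 1 = i + 1 + c) i c]
    at this
  two i := by have := hv.two (i + c); rwa [(by decide : ∀ i c : Fin 5, i + c + 2 = i + 2 + c) i c]
    at this

theorem twin_rotate {v : Fin 5 → V} {c i : Fin 5} {x : V} (h : Twin G v (i + c) x) :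
    Twin G (fun i => v (i + c)) i x where
  one := by have := h.one; rwa [(by decide : ∀ i c : Fin 5, i + c + 1 = i + 1 + c) i c] at this
  two := by have := h.two; rwa [(by decide : ∀ i c : Fin 5, i + c + 2 = i + 2 + c) i c] at this
  three := by
    have := h.three; rwa [(by decide : ∀ i c : Fin 5, i + c + 3 = i + 3 + c) i c] at this
  four := by have := h.four; rwa [(by decide : ∀ i c : Fin 5, i + c + 4 = i + 4 + c) i c] at this

theorem exists_twin (t : Bal G) {v : Fin 5 → V} (hv : Circ G v) {x : V} (hx : ∀ i, x ≠ v i) :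
    ∃ i, Twin G v i x := by
  classical
  have key : ∀ o : Fin 5 → Bool, (∀ i, ¬ (o i = true ∧ o (i + 1) = true ∧ o (i + 3) = true)) →
      (∀ i, ¬ (o i = false ∧ o (i + 1) = false ∧ o (i + 3) = false)) →
      ∃ i, o (i + 1) = true ∧ o (i + 2) = true ∧ o (i + 3) = false ∧ o (i + 4) = false := by
    decide
  have h3 : ∀ i, G.To (v (i + 3)) (v i) := fun i => by
    have := hv.two (i + 3)
    rwa [(by decide : ∀ i : Fin 5, i + 3 + 2 = i) i] at this
  have h2 : ∀ i, G.To (v (i + 1)) (v (i + 3)) := fun i => by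
    have := hv.two (i + 1)
    rwa [(by decide : ∀ i : Fin 5, i + 1 + 2 = i + 3) i] at this
  have hin : ∀ i, ¬ G.To x (v i) → G.To (v i) x := fun i => (t.tot (hx i)).resolve_left
  obtain ⟨i, a1, a2, a3, a4⟩ := key (fun i => decide (G.To x (v i)))
    (fun i => by
      simp only [decide_eq_true_eq]
      exact fun ⟨a, b, c⟩ => t.out_dia (hv.one i) (h2 i) (h3 i) a b c)
    (fun i => by
      simp only [decide_eq_false_iff_not]
      exact fun ⟨a, b, c⟩ => t.in_dia (hv.one i) (h2 i) (h3 i) (hin _ a) (hin _ b) (hin _ c))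
  simp only [decide_eq_true_eq, decide_eq_false_iff_not] at a1 a2 a3 a4
  exact ⟨i, a1, a2, hin _ a3, hin _ a4⟩

theorem twin_same (t : Bal G) {v : Fin 5 → V} (hv : Circ G v) {x y : V} (hxy : x ≠ y)
    (hx0 : x ≠ v 0) (hy0 : y ≠ v 0) (hx : Twin G v 0 x) (hy : Twin G v 0 y) : False :=
  t.fst (hv.one 3).ne hxy hx0 hy0 (hv.one 2) (hv.two 2) hx.two hy.two (hv.two 0) hx.three hy.three
    (hv.two 3) hx.four hy.four (hv.one 4)

theorem twin_next (t : Bal G) {v : Fin 5 → V} (hv : Circ G v) {x y : V} (hxy : x ≠ y)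
    (hx : ∀ i, x ≠ v i) (hy : ∀ i, y ≠ v i) (tx : Twin G v 0 x) (ty : Twin G v 1 y) : False := by
  have x1 : G.To x (v 1) := tx.one
  have x2 : G.To x (v 2) := tx.two
  have x3 : G.To (v 3) x := tx.three
  have x4 : G.To (v 4) x := tx.four
  have y2 : G.To y (v 2) := ty.one
  have y3 : G.To y (v 3) := ty.two
  have y4 : G.To (v 4) y := ty.three
  have y0 : G.To (v 0) y := ty.four
  have h01 : G.To (v 0) (v 1) := hv.one 0
  have h13 : G.To (v 1) (v 3) := hv.two 1
  have h34 : G.To (v 3) (v 4) := hv.one 3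
  have h30 : G.To (v 3) (v 0) := hv.two 3
  have h40 : G.To (v 4) (v 0) := hv.one 4
  have h41 : G.To (v 4) (v 1) := hv.two 4
  rcases t.tot hxy with k | k
  · exact t.snd h40.ne (hx 4).symm (hx 0).symm (hy 1).symm h34 h30 x3 h13 y3 h41 y4 h01 y0 x1 k
  · have a : G.To (v 0) x := (t.tot (hx 0)).resolve_left fun a => t.out_dia a y0 k x4 h40 y4
    have b : G.To y (v 1) := (t.tot (hy 1)).resolve_right fun b => t.out_dia x1 b k a h01 y0
    exact t.out_dia x1 h13 x3 k b y3

theorem twin_two (t : Bal G) {v : Fin 5 → V} (hv : Circ G v) {x y : V} (hxy : x ≠ y)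
    (hx : ∀ i, x ≠ v i) (hy : ∀ i, y ≠ v i) (tx : Twin G v 0 x) (ty : Twin G v 2 y) :
    G.To y x := by
  have h40 : G.To (v 4) (v 0) := hv.one 4
  have h41 : G.To (v 4) (v 1) := hv.two 4
  have h24 : G.To (v 2) (v 4) := hv.two 2
  have h02 : G.To (v 0) (v 2) := hv.two 0
  have h12 : G.To (v 1) (v 2) := hv.one 1
  have h01 : G.To (v 0) (v 1) := hv.one 0
  have x4 : G.To (v 4) x := tx.four
  have x2 : G.To x (v 2) := tx.two
  have y4 : G.To y (v 4) := ty.two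
  have y0 : G.To (v 0) y := ty.three
  have y1 : G.To (v 1) y := ty.four
  exact (t.tot hxy).resolve_left fun k =>
    t.snd (hx 0).symm h01.ne (hx 1) (hy 2).symm h40 x4 h41 h24 y4 h02 y0 x2 k h12 y1

/-- The circular tournament on 7 vertices is self-dual. -/
theorem selfDual_of_seven (t : Bal G) {v : Fin 5 → V} (hv : Circ G v) {x y : V} (hxy : x ≠ y)
    (hx : ∀ i, x ≠ v i) (hy : ∀ i, y ≠ v i) (tx : Twin G v 0 x) (ty : Twin G v 2 y)
    (cov : ∀ z, z = x ∨ z = y ∨ ∃ i, z = v i) : SelfDual G := by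
  have yx := t.twin_two hv hxy hx hy tx ty
  have x1 : G.To x (v 1) := tx.one
  have x2 : G.To x (v 2) := tx.two
  have x3 : G.To (v 3) x := tx.three
  have x4 : G.To (v 4) x := tx.four
  have y3 : G.To y (v 3) := ty.one
  have y4 : G.To y (v 4) := ty.two
  have y0 : G.To (v 0) y := ty.three
  have y1 : G.To (v 1) y := ty.four
  have h01 : G.To (v 0) (v 1) := hv.one 0
  have h12 : G.To (v 1) (v 2) := hv.one 1
  have h23 : G.To (v 2) (v 3) := hv.one 2
  have h34 : G.To (v 3) (v 4) := hv.one 3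
  have h40 : G.To (v 4) (v 0) := hv.one 4
  have h02 : G.To (v 0) (v 2) := hv.two 0
  have h13 : G.To (v 1) (v 3) := hv.two 1
  have h24 : G.To (v 2) (v 4) := hv.two 2
  have h30 : G.To (v 3) (v 0) := hv.two 3
  have h41 : G.To (v 4) (v 1) := hv.two 4
  obtain ⟨x0, y2⟩ := t.backward h02 h24 h40 x2 x4 y4 y0 yx
  have key : ∃ u : Fin 7 → V, Function.Surjective u ∧ (∀ i, G.To (u i) (u (i + 1))) ∧
      (∀ i, G.To (u i) (u (i + 2))) ∧ ∀ i, G.To (u i) (u (i + 3)) := by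
    refine ⟨![v 0, v 1, v 2, y, v 3, v 4, x], fun z => ?_, ?_, ?_, ?_⟩
    · rcases cov z with rfl | rfl | ⟨i, rfl⟩
      · exact ⟨6, rfl⟩
      · exact ⟨3, rfl⟩
      · fin_cases i
        exacts [⟨0, rfl⟩, ⟨1, rfl⟩, ⟨2, rfl⟩, ⟨4, rfl⟩, ⟨5, rfl⟩]
    all_goals intro i; fin_cases i <;> assumption
  obtain ⟨u, hs, h1, h2, h3⟩ := key
  have split : ∀ i j : Fin 7, i = j ∨ (j = i + 1 ∨ j = i + 2 ∨ j = i + 3) ∨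
      (i = j + 1 ∨ i = j + 2 ∨ i = j + 3) := by decide
  have fwd : ∀ {i j : Fin 7}, (j = i + 1 ∨ j = i + 2 ∨ j = i + 3) → G.To (u i) (u j) := by
    rintro i j (rfl | rfl | rfl)
    exacts [h1 i, h2 i, h3 i]
  refine selfDual_of_enum u ?_ hs (Equiv.neg (Fin 7)) ?_
  · intro i j hij
    rcases split i j with h | h | h
    · exact h
    · exact absurd hij (fwd h).ne
    · exact absurd hij.symm (fwd h).ne
  · have neg : ∀ i j : Fin 7, (j = i + 1 ∨ j = i + 2 ∨ j = i + 3) →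
        (-i = -j + 1 ∨ -i = -j + 2 ∨ -i = -j + 3) := by decide
    intro i j
    simp only [Equiv.neg_apply]
    rcases split i j with rfl | h | h
    · simp [G.irrefl]
    · exact iff_of_true (fwd h).1 (fwd (neg i j h)).1
    · exact iff_of_false (fwd h).2 (fwd (neg j i h)).2

theorem twin_diff (t : Bal G) {v : Fin 5 → V} (hv : Circ G v) {x y : V} (hxy : x ≠ y)
    (hx : ∀ i, x ≠ v i) (hy : ∀ i, y ≠ v i) {i j : Fin 5} (tx : Twin G v i x)
    (ty : Twin G v j y) : j = i + 2 ∨ i = j + 2 := by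
  have key : ∀ i j : Fin 5, j = 0 + i ∨ j = 1 + i ∨ i = 1 + j ∨ j = i + 2 ∨ i = j + 2 := by decide
  have zero : ∀ i : Fin 5, 0 + i = i := by decide
  rcases key i j with rfl | rfl | rfl | h | h
  · exact (t.twin_same (Circ.rotate hv i) hxy (hx _) (hy _)
      (twin_rotate ((zero i).symm ▸ tx)) (twin_rotate ty)).elim
  · exact (t.twin_next (Circ.rotate hv i) hxy (fun _ => hx _) (fun _ => hy _)
      (twin_rotate ((zero i).symm ▸ tx)) (twin_rotate ty)).elim
  · exact (t.twin_next (Circ.rotate hv j) hxy.symm (fun _ => hy _) (fun _ => hx _)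
      (twin_rotate ((zero j).symm ▸ ty)) (twin_rotate tx)).elim
  · exact Or.inl h
  · exact Or.inr h

theorem selfDual_of_circ (t : Bal G) (h : Cls G G') (h6 : LeHypo 6 G G') (hpre : Pre G)
    {v : Fin 5 → V} (hv : Circ G v) : SelfDual G := by
  by_cases h1 : ∃ x, ∀ z, z = x ∨ ∃ i, z = v i
  · obtain ⟨x, hx⟩ := h1
    refine selfDual_of_surj h h6 hpre ![v 0, v 1, v 2, v 3, v 4, x] (fun z => ?_) le_rfl
    rcases hx z with rfl | ⟨i, rfl⟩
    · exact ⟨5, rfl⟩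
    · fin_cases i
      exacts [⟨0, rfl⟩, ⟨1, rfl⟩, ⟨2, rfl⟩, ⟨3, rfl⟩, ⟨4, rfl⟩]
  push Not at h1
  obtain ⟨x, -, hx⟩ := h1 (v 0)
  obtain ⟨y, hyx, hy⟩ := h1 x
  obtain ⟨i, tx⟩ := t.exists_twin hv hx
  obtain ⟨j, ty⟩ := t.exists_twin hv hy
  have dxy := t.twin_diff hv hyx.symm hx hy tx ty
  have cov : ∀ z, z = x ∨ z = y ∨ ∃ i, z = v i := by
    intro z
    by_contra hz
    push Not at hz
    obtain ⟨zx, zy, hz⟩ := hz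
    obtain ⟨k, tz⟩ := t.exists_twin hv hz
    have dxz := t.twin_diff hv zx hz hx tz tx
    have dyz := t.twin_diff hv zy hz hy tz ty
    have no : ∀ i j k : Fin 5, (j = i + 2 ∨ i = j + 2) → (i = k + 2 ∨ k = i + 2) →
        ¬ (j = k + 2 ∨ k = j + 2) := by decide
    exact no i j k dxy dxz dyz
  have zero : ∀ i : Fin 5, 0 + i = i := by decide
  have comm : ∀ i : Fin 5, i + 2 = 2 + i := by decide
  have shift : ∀ c : Fin 5, ∀ z, (∃ i, z = v i) → ∃ i, z = v (i + c) := by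
    rintro c _ ⟨i, rfl⟩
    exact ⟨i - c, by rw [(by decide : ∀ i c : Fin 5, i - c + c = i) i c]⟩
  rcases dxy with rfl | rfl
  · exact t.selfDual_of_seven (Circ.rotate hv i) hyx.symm (fun _ => hx _) (fun _ => hy _)
      (twin_rotate ((zero i).symm ▸ tx)) (twin_rotate (comm i ▸ ty)) fun z => by
        have := cov z; have := shift i z; tauto
  · exact t.selfDual_of_seven (Circ.rotate hv j) hyx (fun _ => hy _) (fun _ => hx _)
      (twin_rotate ((zero j).symm ▸ ty)) (twin_rotate (comm j ▸ tx)) fun z => by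
        have := cov z; have := shift j z; tauto

end Bal

/-- A prechain tournament which is a single difference class of `(≤ 6)`-hypomorphic digraphs is
self-dual. -/
theorem selfDual_of_tournament (h : Cls G G') (h6 : LeHypo 6 G G') (hp : Pre G)
    (hN : NoInfChain G) (hT : G.IsTournament) : SelfDual G := by
  by_cases hc : ∃ x y z, G.To x y ∧ G.To y z ∧ G.To z x
  · obtain ⟨x, y, z, h1, h2, h3⟩ := hc
    have t : Bal G := bal_of h h6 hp fun {x y} hne => hT x y hne
    rcases t.circ_or_selfDual hN h h6 hp h1 h2 h3 with hs | ⟨v, hv⟩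
    · exact hs
    · exact t.selfDual_of_circ h h6 hp hv
  · push Not at hc
    exact selfDual_of_chain (isChainD_of hT hc) hN

end Circular

section Assembly
variable {G G' : Dgraph V}

theorem cls_of_diffClass {C : Set V} (h : LeHypo 4 G G') (hC : DiffClass G G' C) :
    Cls (G.ind C) (G'.ind C) := ⟨h.restrict C, diffClass_conn h hC⟩

/-- A proper difference class of a prechain induces a chain. -/
theorem isChainD_of_ne_univ (h : LeHypo 4 G G') (hp : Pre G) {C : Set V} (hC : DiffClass G G' C)
    (hne : C ≠ Set.univ) : (G.ind C).IsChainD := by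
  obtain ⟨c, hc⟩ := (Set.ne_univ_iff_exists_notMem C).1 hne
  have to_of : ∀ {a b}, a ∈ C → b ∈ C → (G.To c a → G.To c b) ∧ (G.To a c → G.To b c) :=
    fun ha hb => by
      have := diffClass_uniform h hC ha hb hc
      unfold To; tauto
  have nt : ∀ {a b}, a ∈ C → b ∈ C → a ≠ b → ¬ G.Neutral c a := by
    intro a b ha hb hab hn
    have h1 := diffClass_uniform h hC ha hb hc
    have h2 := (neutral_iff _ _ _).1 hn
    have h3 : G.Neutral c b := (neutral_iff _ _ _).2 ⟨fun h' => hc (h' ▸ hb), by tauto⟩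
    exact hab (hp.nn hn h3)
  have cd : ∀ {a b}, a ∈ C → b ∈ C → a ≠ b → G.To c a ∨ G.To a c := by
    intro a b ha hb hab
    have hca : c ≠ a := fun h' => hc (h' ▸ ha)
    have := nt ha hb hab
    have := G.trichotomy hca
    tauto
  refine isChainD_of ?_ ?_
  · rintro ⟨a, ha⟩ ⟨b, hb⟩ hab
    have hab : a ≠ b := fun h' => hab (Subtype.ext h')
    rcases G.trichotomy hab with k | k | k
    · exact Or.inl k
    · exact Or.inr k
    · rcases cd ha hb hab with l | l
      · exact absurd ((to_of ha hb).1 l) (hp.out_peak k l)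
      · exact absurd ((to_of ha hb).2 l) (hp.in_peak k l)
  · rintro ⟨x, hx⟩ ⟨y, hy⟩ ⟨z, hz⟩ h1 h2 h3
    have h1 : G.To x y := h1
    rcases cd hx hy h1.ne with l | l
    · exact hp.out_dia h1 h2 h3 l ((to_of hx hy).1 l) ((to_of hx hz).1 l)
    · exact hp.in_dia h1 h2 h3 l ((to_of hx hy).2 l) ((to_of hx hz).2 l)

theorem hemi_of_prechain (h : LeHypo 4 G G') (hcinf : ¬ G.CondCinf) {C : Set V}
    (hC : DiffClass G G' C) (hns : ¬ SelfDual (G.ind C)) (hp : Pre G) : Hemi G G' := by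
  have hun : C = Set.univ := by
    by_contra hne
    exact hns (selfDual_of_chain (isChainD_of_ne_univ h hp hC hne) (noInfChain_of_class h hC hcinf))
  subst hun
  have hcls : Cls G G' := ⟨h, fun x y =>
    Relation.ReflTransGen.lift (p := DiffStep G G') Subtype.val (fun _ _ hab => hab)
      (⟨x, trivial⟩ : (Set.univ : Set V)) ⟨y, trivial⟩ (diffClass_conn h hC _ _)⟩
  refine Or.inr (dual_iso hcls hp fun I h1 h2 => ?_)
  by_contra h3
  exact hcinf (Or.inl ⟨I, h3, h1, h2⟩)

theorem consecutivity_or_pre (h : Cls G G') (hns : ¬ SelfDual G) :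
    G.OneEndInfiniteConsecutivity ∨ Pre G := by
  by_cases hn : ∃ x y z, y ≠ z ∧ G.Neutral x y ∧ G.Neutral x z
  · obtain ⟨x, y, z, h1, h2, h3⟩ := hn
    exact Or.inl ((h.consecutivity h2 h3 h1).resolve_left hns)
  · exact Or.inr (h.pre fun {x y z} h1 h2 => by_contra fun h3 => hn ⟨x, y, z, h3, h1, h2⟩)

theorem isTournament_of (h : Cls G G') (h5 : LeHypo 5 G G') (hp : Pre G) (hN : NoInfChain G)
    (hns : ¬ SelfDual G) : G.IsTournament := fun x y hxy => by
  by_contra hd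
  exact hns (selfDual_of_neutral h h5 hp hN ⟨hxy, hd⟩)

end Assembly
end Dgraph

/-- Corollary 454: non-self-dual difference classes of (≤k)-hypomorphic digraphs
when G does not satisfy C∞. -/
theorem corollary_454 {V : Type u} (k : ℕ) (hk : 4 ≤ k) (G G' : Dgraph V)
    (hhypo : Dgraph.LeHypo k G G') (hcinf : ¬ G.CondCinf)
    (C : Set V) (hC : Dgraph.DiffClass G G' C) (hnsd : ¬ Dgraph.SelfDual (G.ind C)) :
    (k = 4 → (G.ind C).OneEndInfiniteConsecutivity ∨ Dgraph.ProperPrechain (G.ind C)) ∧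
    (k = 5 → (G.ind C).OneEndInfiniteConsecutivity ∨
      Dgraph.DiamondFreeTournament (G.ind C)) ∧
    (k = 6 → (G.ind C).OneEndInfiniteConsecutivity) ∧
    (G.IsPrechain → Dgraph.Hemi G G') := by
  have h4 := hhypo.mono hk
  have hcls := cls_of_diffClass h4 hC
  have hN := noInfChain_of_class h4 hC hcinf
  have hor := consecutivity_or_pre hcls hnsd
  refine ⟨?_, ?_, ?_, ?_⟩
  · rintro rfl
    exact hor.imp_right fun hp => ⟨(isPrechain_iff _).2 hp, fun hc => hnsd (selfDual_of_chain hc hN)⟩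
  · rintro rfl
    exact hor.imp_right fun hp => ⟨isTournament_of hcls (hhypo.restrict C) hp hN hnsd,
      ((isPrechain_iff _).2 hp).2.1⟩
  · rintro rfl
    refine hor.resolve_right fun hp => ?_
    exact hnsd (selfDual_of_tournament hcls (hhypo.restrict C) hp hN
      (isTournament_of hcls ((hhypo.mono (by norm_num)).restrict C) hp hN hnsd))
  · exact fun hp => hemi_of_prechain h4 hcinf hC hnsd ((isPrechain_iff _).1 hp)
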